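/- For every h₂ with 0.676 < h₂ < 0.686, one has I₁(h₂) > 0 and there exists K ∈ (−1, 1) such that I₁(h₂) + I₂(h₂, K) < 0; that is, for these heights of the permeability jump, the curve does not shift in the homogeneous case K = 0, but the permeabilities help the shift: some permeability jump K produces a short-time stability shift. -/

import Mathlib

open MeasureTheory Real

/-- First component of the initial interface: `z₁(α) = α - sin(α) e^{-10⁻⁴ α²}`. -/
noncomputable def z₁ (α : ℝ) : ℝ := α - Real.sin α * Real.exp (-(1 / 10000) * α ^ 2)

/-- Second component of the initial interface, depending on the height `h₂` of the
permeability jump. -/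
noncomputable def z₂ (h₂ α : ℝ) : ℝ :=
  if |α| ≤ π then
    h₂ * (3 / π) *
      (Real.sin (3 * α) / 3 -
        Real.sin α / 2.5 * (Real.exp (-(α + 2) ^ 2) + Real.exp (-(α - 2) ^ 2)))
  else 0

/-- The homogeneous part `I₁(h₂)` of `∂ₜ RT(0,0)` (up to a positive constant). -/
noncomputable def I₁ (h₂ : ℝ) : ℝ :=
  2 * deriv (z₂ h₂) 0 *
    ∫ β in Set.Ioi (0 : ℝ),
      (deriv z₁ β * Real.sinh (z₁ β) * Real.sin (z₂ h₂ β) /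
          (Real.cosh (z₁ β) - Real.cos (z₂ h₂ β)) ^ 2 +
        deriv z₁ β * Real.sinh (z₁ β) * Real.sin (z₂ h₂ β) /
          (Real.cosh (z₁ β) + Real.cos (z₂ h₂ β)) ^ 2)

/-- The inhomogeneous part `I₂(h₂, K)` of `∂ₜ RT(0,0)` (up to a positive constant),
a double integral over `(0,∞)²` in the variables `(y, γ)`. -/
noncomputable def I₂ (h₂ K : ℝ) : ℝ :=
  4 * deriv (z₂ h₂) 0 * K *
    ∫ p in Set.Ioi (0 : ℝ) ×ˢ Set.Ioi (0 : ℝ),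
      deriv (z₂ h₂) p.2 * Real.cos (z₁ p.2 * p.1) /
          ((Real.sinh (π * p.1) + K * Real.sinh (2 * h₂ * p.1)) *
            Real.cosh (p.1 * π / 2)) *
        (2 * p.1 * Real.cosh (p.1 * π / 2 - p.1 * h₂) * Real.cosh (p.1 * π / 2) -
          2 * Real.sinh (p.1 * h₂) / Real.tan h₂) *
        Real.cosh (p.1 * z₂ h₂ p.2) * Real.cosh (p.1 * (π / 2 - h₂))

/-! ### Fixed point midpoint-radius arithmetic -/

/-- Midpoint and radius, both in units of `2 ^ (-40)`. -/
structure MR where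
  m : Int
  r : Nat

/-- The real number `x` lies in the ball `a`. -/
def Enc (x : ℝ) (a : MR) : Prop := |x * 1099511627776 - (a.m : ℝ)| ≤ (a.r : ℝ)

namespace MR

def add (a b : MR) : MR := ⟨Int.add a.m b.m, Nat.add a.r b.r⟩
def neg (a : MR) : MR := ⟨Int.neg a.m, a.r⟩
def sub (a b : MR) : MR := add a (neg b)
def mul (a b : MR) : MR :=
  ⟨Int.shiftRight (Int.mul a.m b.m) 40,
   Nat.add (Nat.shiftRight (Nat.add (Nat.mul (Int.natAbs a.m) b.r)
     (Nat.mul a.r (Nat.add (Int.natAbs b.m) b.r))) 40) 2⟩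
def mulN (n : Nat) (a : MR) : MR := ⟨Int.mul (Int.ofNat n) a.m, Nat.mul n a.r⟩
def divN (n : Nat) (a : MR) : MR := ⟨Int.ediv a.m (Int.ofNat n), Nat.add (Nat.div a.r n) 2⟩
def one : MR := ⟨Int.ofNat 1099511627776, 0⟩
def widen (e : Nat) (a : MR) : MR := ⟨a.m, Nat.add a.r e⟩
def inv (a : MR) : MR :=
  ⟨Int.ofNat (Nat.div 1208925819614629174706176 (Int.toNat a.m)),
    Nat.add (Nat.div (Nat.mul a.r 1208925819614629174706176)
      (Nat.mul (Int.toNat a.m) (Nat.sub (Int.toNat a.m) a.r))) 2⟩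
def horner (t : MR) : List Nat → MR
  | [] => one
  | n :: l => add one (divN n (mul t (horner t l)))
def sqn : Nat → MR → MR
  | 0, a => a
  | n+1, a => sqn n (mul a a)
def exp0 (a : MR) : MR := sqn 6 (widen 20 (horner (divN 64 a) [1,2,3,4,5,6,7,8,9,10]))
def exp (a : MR) : MR :=
  mul (exp0 ⟨a.m, 0⟩) (add one (add ⟨0, a.r⟩ (mul ⟨0, a.r⟩ ⟨0, a.r⟩)))
def dbl : Nat → MR × MR → MR × MR
  | 0, p => p
  | n+1, p => dbl n (mulN 2 (mul p.1 p.2), sub one (mulN 2 (mul p.1 p.1)))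
def sc0 (t : MR) : MR × MR :=
  dbl 3 (widen 4 (mul t (horner (neg (mul t t)) [6,20,42,72,110])),
    widen 4 (horner (neg (mul t t)) [2,12,30,56,90]))
def sin (a : MR) : MR := widen a.r (sc0 (divN 8 ⟨a.m, 0⟩)).1
def cos (a : MR) : MR := widen a.r (sc0 (divN 8 ⟨a.m, 0⟩)).2
/-- Every real in the ball is positive. -/
def pos (a : MR) : Bool := Nat.blt a.r (Int.toNat a.m)
def okExp (a : MR) : Bool :=
  and (Nat.ble (Int.natAbs a.m) 35184372088832) (Nat.ble a.r 1099511627776)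
def okSin (a : MR) : Bool := Nat.ble (Int.natAbs a.m) 4398046511104
/-- Upper bound for the absolute value. -/
def mag (a : MR) : Nat := Nat.add (Int.natAbs a.m) a.r

end MR

namespace Enc

theorem add {x y : ℝ} {a b : MR} (ha : Enc x a) (hb : Enc y b) : Enc (x + y) (a.add b) := by
  simp only [Enc, MR.add, Int.add_def, Nat.add_eq] at *
  push_cast
  rw [abs_le] at *
  constructor <;> linarith [ha.1, ha.2, hb.1, hb.2]

theorem neg {x : ℝ} {a : MR} (ha : Enc x a) : Enc (-x) a.neg := by
  have e : (Int.neg a.m) = - a.m := rfl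
  simp only [Enc, MR.neg, e] at *
  push_cast
  rw [abs_le] at *
  constructor <;> linarith [ha.1, ha.2]

theorem sub {x y : ℝ} {a b : MR} (ha : Enc x a) (hb : Enc y b) : Enc (x - y) (a.sub b) := by
  rw [sub_eq_add_neg]; exact ha.add hb.neg

theorem shift_int (m : ℤ) : |((Int.shiftRight m 40 : ℤ) : ℝ) - (m : ℝ) / 1099511627776| ≤ 1 := by
  have e : Int.shiftRight m 40 = m / 1099511627776 := by
    have := Int.shiftRight_eq_div_pow m 40
    norm_num at this
    exact this
  rw [e]
  have h1 := Int.emod_add_mul_ediv m 1099511627776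
  have h2 := Int.emod_nonneg m (b := 1099511627776) (by norm_num)
  have h3 := Int.emod_lt_of_pos m (b := 1099511627776) (by norm_num)
  have h1' : ((m % 1099511627776 : ℤ) : ℝ) + 1099511627776 * ((m / 1099511627776 : ℤ) : ℝ) = m := by
    exact_mod_cast h1
  have h2' : (0 : ℝ) ≤ ((m % 1099511627776 : ℤ) : ℝ) := by exact_mod_cast h2
  have h3' : ((m % 1099511627776 : ℤ) : ℝ) < 1099511627776 := by exact_mod_cast h3
  rw [← h1', add_div, mul_div_cancel_left₀ _ (by norm_num : (1099511627776 : ℝ) ≠ 0), abs_le]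
  have h4 : ((m % 1099511627776 : ℤ) : ℝ) / 1099511627776 ≤ 1 := by
    rw [div_le_one (by norm_num)]; exact h3'.le
  have h5 : 0 ≤ ((m % 1099511627776 : ℤ) : ℝ) / 1099511627776 := by positivity
  constructor <;> linarith

theorem shift_nat (n : ℕ) : (n : ℝ) / 1099511627776 ≤ ((Nat.shiftRight n 40 : ℕ) : ℝ) + 1 := by
  have e : Nat.shiftRight n 40 = n / 1099511627776 := by
    have := Nat.shiftRight_eq_div_pow n 40
    norm_num at this
    exact this
  rw [e, div_le_iff₀ (by norm_num)]
  have h1 := Nat.mod_add_div n 1099511627776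
  have h3 := Nat.mod_lt n (y := 1099511627776) (by norm_num)
  have h4 : n ≤ (n / 1099511627776 + 1) * 1099511627776 := by omega
  exact_mod_cast h4

theorem div_nat (n k : ℕ) (hk : 0 < k) : (n : ℝ) / k ≤ ((n / k : ℕ) : ℝ) + 1 := by
  have hk' : (0 : ℝ) < k := by exact_mod_cast hk
  rw [div_le_iff₀ hk']
  have h4 : n ≤ (n / k + 1) * k := by
    have := Nat.lt_div_mul_add (a := n) hk
    nlinarith
  exact_mod_cast h4

theorem div_int (m : ℤ) (k : ℕ) (hk : 0 < k) : |((m / (k : ℤ) : ℤ) : ℝ) - (m : ℝ) / k| ≤ 1 := by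
  have hk' : (0 : ℝ) < k := by exact_mod_cast hk
  have hk2 : (0 : ℤ) < k := by exact_mod_cast hk
  have h1 := Int.emod_add_mul_ediv m k
  have h2 := Int.emod_nonneg m (b := k) hk2.ne'
  have h3 := Int.emod_lt_of_pos m (b := k) hk2
  have h1' : ((m % k : ℤ) : ℝ) + k * ((m / (k : ℤ) : ℤ) : ℝ) = m := by exact_mod_cast h1
  have h2' : (0 : ℝ) ≤ ((m % k : ℤ) : ℝ) := by exact_mod_cast h2
  have h3' : ((m % k : ℤ) : ℝ) < k := by exact_mod_cast h3
  have h4 : ((m % k : ℤ) : ℝ) / k ≤ 1 := by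
    rw [div_le_one hk']; exact h3'.le
  have h5 : 0 ≤ ((m % k : ℤ) : ℝ) / k := by positivity
  rw [← h1', add_div, mul_div_cancel_left₀ _ hk'.ne', abs_le]
  constructor <;> linarith

theorem mul_aux {X Y a b r s : ℝ} (h1 : |X - a| ≤ r) (h2 : |Y - b| ≤ s) :
    |X * Y - a * b| ≤ |a| * s + r * (|b| + s) := by
  have hY : |Y| ≤ |b| + s := by
    calc |Y| = |b + (Y - b)| := by ring_nf
      _ ≤ |b| + |Y - b| := abs_add_le _ _
      _ ≤ _ := by linarith
  calc |X * Y - a * b| = |a * (Y - b) + (X - a) * Y| := by ring_nf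
    _ ≤ |a * (Y - b)| + |(X - a) * Y| := abs_add_le _ _
    _ = |a| * |Y - b| + |X - a| * |Y| := by rw [abs_mul, abs_mul]
    _ ≤ _ := by
      have := (abs_nonneg (X - a)).trans h1
      gcongr

theorem mul {x y : ℝ} {a b : MR} (ha : Enc x a) (hb : Enc y b) : Enc (x * y) (a.mul b) := by
  have h := mul_aux ha hb
  unfold Enc MR.mul
  have e1 : Int.mul a.m b.m = a.m * b.m := rfl
  simp only [e1, Nat.add_eq, Nat.mul_eq]
  have h1 := shift_int (a.m * b.m)
  have h2 := shift_nat (a.m.natAbs * b.r + a.r * (b.m.natAbs + b.r))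
  push_cast at h1 h2 ⊢
  have e2 : x * y * 1099511627776 = x * 1099511627776 * (y * 1099511627776) / 1099511627776 := by
    field_simp
  rw [e2]
  have h3 : |x * 1099511627776 * (y * 1099511627776) / 1099511627776 - a.m * b.m / 1099511627776|
      ≤ (|(a.m : ℝ)| * b.r + a.r * (|(b.m : ℝ)| + b.r)) / 1099511627776 := by
    rw [← sub_div, abs_div, abs_of_pos (by norm_num : (0 : ℝ) < 1099511627776)]
    gcongr
  rw [Nat.cast_natAbs, Nat.cast_natAbs, Int.cast_abs, Int.cast_abs] at h2
  rw [abs_le] at h1 h3 ⊢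
  constructor <;> linarith [h1.1, h1.2, h3.1, h3.2]

theorem mulN {x : ℝ} {a : MR} (n : ℕ) (ha : Enc x a) : Enc (n * x) (a.mulN n) := by
  have e1 : Int.mul (Int.ofNat n) a.m = n * a.m := rfl
  simp only [Enc, MR.mulN, e1, Nat.mul_eq] at *
  push_cast
  have : (n : ℝ) * x * 1099511627776 - n * a.m = n * (x * 1099511627776 - a.m) := by ring
  rw [this, abs_mul, Nat.abs_cast]
  gcongr

theorem divN {x : ℝ} {a : MR} (n : ℕ) (hn : 0 < n) (ha : Enc x a) : Enc (x / n) (a.divN n) := by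
  have e1 : Int.ediv a.m (Int.ofNat n) = a.m / (n : ℤ) := rfl
  have e2 : Nat.div a.r n = a.r / n := rfl
  simp only [Enc, MR.divN, e1, e2, Nat.add_eq] at *
  push_cast
  have hn' : (0 : ℝ) < n := by exact_mod_cast hn
  have h1 := div_int a.m n hn
  have h2 := div_nat a.r n hn
  have h3 : |x / n * 1099511627776 - a.m / n| ≤ a.r / n := by
    have : x / n * 1099511627776 - a.m / n = (x * 1099511627776 - a.m) / n := by ring
    rw [this, abs_div, Nat.abs_cast]
    gcongr
  rw [abs_le] at h1 h3 ⊢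
  constructor <;> linarith [h1.1, h1.2, h3.1, h3.2]

theorem one : Enc 1 MR.one := by
  simp [Enc, MR.one]

theorem zero (r : ℕ) : Enc 0 ⟨0, r⟩ := by
  simp [Enc]

theorem widen {x y : ℝ} {a : MR} {e : ℕ} (ha : Enc x a) (h : |y - x| * 1099511627776 ≤ e) :
    Enc y (a.widen e) := by
  simp only [Enc, MR.widen, Nat.add_eq] at *
  push_cast
  have h' : |(y - x) * 1099511627776| ≤ e := by
    rw [abs_mul, abs_of_pos (by norm_num : (0 : ℝ) < 1099511627776)]; exact h
  rw [abs_le] at *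
  constructor <;> linarith [ha.1, ha.2, h'.1, h'.2]

theorem pos_iff {a : MR} (h : a.pos = true) : a.r < a.m.toNat := by
  simpa [MR.pos, Nat.blt_eq] using h

theorem pos {x : ℝ} {a : MR} (ha : Enc x a) (h : a.pos = true) : 0 < x := by
  have h1 := pos_iff h
  have h2 : (a.r : ℤ) < a.m := by omega
  have h3 : (a.r : ℝ) < a.m := by exact_mod_cast h2
  unfold Enc at ha
  rw [abs_le] at ha
  linarith [ha.1]

theorem inv {x : ℝ} {a : MR} (ha : Enc x a) (h : a.pos = true) : Enc (x⁻¹) a.inv := by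
  have h1 := pos_iff h
  have hx := ha.pos h
  obtain ⟨k, hk⟩ : ∃ k : ℕ, a.m = k := ⟨a.m.toNat, by omega⟩
  unfold Enc at ha
  have e2 : ∀ p q, Nat.div p q = p / q := fun _ _ => rfl
  simp only [Enc, MR.inv, e2, Nat.add_eq, Nat.mul_eq, Nat.sub_eq]
  rw [hk] at h1 ha ⊢
  simp only [Int.toNat_natCast] at h1 ⊢
  have hk0 : 0 < k := by omega
  have hkr : 0 < k * (k - a.r) := Nat.mul_pos hk0 (by omega)
  have b1 := div_int 1208925819614629174706176 k hk0
  have b2 := div_nat (a.r * 1208925819614629174706176) (k * (k - a.r)) hkr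
  have e3 : ((Int.ofNat (1208925819614629174706176 / k) : ℤ) : ℝ)
      = (((1208925819614629174706176 : ℤ) / (k : ℤ) : ℤ) : ℝ) := by
    norm_cast
  rw [e3]
  push_cast [Nat.cast_sub h1.le] at b1 b2 ha ⊢
  have hkk : (0 : ℝ) < k := by exact_mod_cast hk0
  have hrk : (a.r : ℝ) < k := by exact_mod_cast h1
  rw [abs_le] at ha
  have hX : (k : ℝ) - a.r ≤ x * 1099511627776 := by linarith [ha.1]
  have hd : (0 : ℝ) < k - a.r := by linarith
  have b3 : |x⁻¹ * 1099511627776 - 1208925819614629174706176 / k|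
      ≤ a.r * 1208925819614629174706176 / (k * (k - a.r)) := by
    have : x⁻¹ * 1099511627776 - 1208925819614629174706176 / (k : ℝ)
        = 1208925819614629174706176 * (k - x * 1099511627776) / (k * (x * 1099511627776)) := by
      field_simp
      ring
    rw [this, abs_div, abs_mul, abs_of_pos (by norm_num : (0 : ℝ) < 1208925819614629174706176),
      abs_of_pos (by positivity : 0 < (k : ℝ) * (x * 1099511627776)), mul_comm]
    have : |(k : ℝ) - x * 1099511627776| ≤ a.r := by
      rw [abs_le]; constructor <;> linarith [ha.1, ha.2]
    gcongr
  rw [abs_le] at b1 b3 ⊢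
  constructor <;> linarith [b1.1, b1.2, b3.1, b3.2]

/-- The Horner form evaluated on reals. -/
noncomputable def hornerR (t : ℝ) : List ℕ → ℝ
  | [] => 1
  | n :: l => 1 + t * hornerR t l / n

theorem horner {t : ℝ} {a : MR} (ha : Enc t a) : ∀ l : List ℕ, (∀ n ∈ l, 0 < n) →
    Enc (hornerR t l) (a.horner l)
  | [], _ => one
  | n :: l, h => one.add ((ha.mul (horner ha l (fun k hk => h k (by simp [hk])))).divN n
      (h n (by simp)))

theorem sqn {x : ℝ} {a : MR} : ∀ n : ℕ, Enc x a → Enc (x ^ 2 ^ n) (a.sqn n)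
  | 0, h => by simpa [MR.sqn] using h
  | n+1, h => by
    have := sqn n (h.mul h)
    rw [MR.sqn]
    convert this using 1
    rw [pow_succ, ← sq, ← pow_mul, mul_comm]

theorem exact (m : ℤ) : Enc ((m : ℝ) / 1099511627776) ⟨m, 0⟩ := by
  simp [Enc]

theorem exp0 (m : ℤ) (h : m.natAbs ≤ 35184372088832) :
    Enc (Real.exp ((m : ℝ) / 1099511627776)) (MR.exp0 ⟨m, 0⟩) := by
  set x := (m : ℝ) / 1099511627776 with hx
  have hm : |(m : ℝ)| ≤ 35184372088832 := by
    rw [← Int.cast_abs, Int.abs_eq_natAbs]; exact_mod_cast h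
  have ht : |x / 64| ≤ 1 / 2 := by
    rw [hx, abs_div, abs_div, abs_of_pos (by norm_num : (0 : ℝ) < 64),
      abs_of_pos (by norm_num : (0 : ℝ) < 1099511627776)]
    rw [div_div, div_le_iff₀ (by norm_num)]
    linarith
  have h1 : Enc (x / (64 : ℕ)) (MR.divN 64 ⟨m, 0⟩) := (exact m).divN 64 (by norm_num)
  have h2 := horner h1 [1,2,3,4,5,6,7,8,9,10] (by simp)
  have hb := Real.exp_bound (x := x / 64) (by linarith) (n := 11) (by norm_num)
  have h3 : Enc (Real.exp (x / 64)) (MR.widen 20 (MR.horner (MR.divN 64 ⟨m, 0⟩)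
      [1,2,3,4,5,6,7,8,9,10])) := by
    refine h2.widen ?_
    have e : hornerR (x / (64 : ℕ)) [1,2,3,4,5,6,7,8,9,10]
        = ∑ m ∈ Finset.range 11, (x / 64) ^ m / (m.factorial : ℝ) := by
      simp [hornerR, Finset.sum_range_succ, Nat.factorial]
      ring
    rw [e]
    have hp : |x / 64| ^ 11 ≤ (1 / 2) ^ 11 := by gcongr
    have : |x / 64| ^ 11 * (((11 : ℕ).succ : ℝ) / (((11 : ℕ).factorial : ℝ) * (11 : ℕ))) ≤
      (1 / 2) ^ 11 * (((11 : ℕ).succ : ℝ) / (((11 : ℕ).factorial : ℝ) * (11 : ℕ))) := by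
      gcongr
    have h5 := hb.trans this
    refine (mul_le_mul_of_nonneg_right h5 (by norm_num)).trans ?_
    norm_num [Nat.factorial]
  have h4 := h3.sqn 6
  unfold MR.exp0
  convert h4 using 1
  rw [← Real.exp_nat_mul]
  congr 1
  push_cast
  ring

theorem exp {x : ℝ} {a : MR} (ha : Enc x a) (h : a.okExp = true) : Enc (Real.exp x) a.exp := by
  simp only [MR.okExp, Bool.and_eq_true, Nat.ble_eq] at h
  have h0 := exp0 a.m h.1
  set x0 := (a.m : ℝ) / 1099511627776 with hx0
  set δ := x - x0 with hδ
  have hδ' : Enc δ ⟨0, a.r⟩ := by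
    unfold Enc at ha ⊢
    have : δ * 1099511627776 - ((0 : ℤ) : ℝ) = x * 1099511627776 - a.m := by
      rw [hδ, hx0]; push_cast; ring
    rw [this]; exact ha
  have hr : (a.r : ℝ) ≤ 1099511627776 := by exact_mod_cast h.2
  have hδ1 : |δ| ≤ 1 := by
    unfold Enc at hδ'
    simp only [Int.cast_zero, sub_zero, abs_mul,
      abs_of_pos (by norm_num : (0 : ℝ) < 1099511627776)] at hδ'
    linarith
  have hw : Enc (Real.exp δ - 1 - δ) (MR.mul ⟨0, a.r⟩ ⟨0, a.r⟩) := by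
    have hb := Real.abs_exp_sub_one_sub_id_le hδ1
    by_cases hz : δ = 0
    · have := (zero a.r).mul (zero a.r)
      simpa [hz] using this
    · have h3 : Enc ((Real.exp δ - 1 - δ) / δ) ⟨0, a.r⟩ := by
        unfold Enc at hδ' ⊢
        refine le_trans ?_ hδ'
        simp only [Int.cast_zero, sub_zero, abs_mul]
        refine mul_le_mul_of_nonneg_right ?_ (by positivity)
        rw [abs_div, div_le_iff₀ (abs_pos.mpr hz)]
        calc _ ≤ δ ^ 2 := hb
          _ = |δ| * |δ| := by rw [← abs_mul, ← sq, abs_of_nonneg (sq_nonneg δ)]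
      have := hδ'.mul h3
      rwa [mul_div_cancel₀ _ hz] at this
  have := h0.mul (one.add (hδ'.add hw))
  unfold MR.exp
  convert this using 1
  rw [show x = x0 + δ by rw [hδ]; ring, Real.exp_add]
  ring

theorem dbl {θ : ℝ} : ∀ (n : ℕ) (p : MR × MR), Enc (Real.sin θ) p.1 → Enc (Real.cos θ) p.2 →
    Enc (Real.sin (2 ^ n * θ)) (MR.dbl n p).1 ∧ Enc (Real.cos (2 ^ n * θ)) (MR.dbl n p).2 := by
  intro n
  induction n generalizing θ with
  | zero => intro p h1 h2; simpa [MR.dbl] using And.intro h1 h2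
  | succ n ih =>
    intro p h1 h2
    have e1 : Enc (Real.sin (2 * θ)) (MR.mulN 2 (MR.mul p.1 p.2)) := by
      have h3 := Enc.mulN 2 (h1.mul h2)
      have h4 : Real.sin (2 * θ) = ((2 : ℕ) : ℝ) * (Real.sin θ * Real.cos θ) := by
        rw [Real.sin_two_mul]; push_cast; ring
      rw [h4]; exact h3
    have e2 : Enc (Real.cos (2 * θ)) (MR.sub MR.one (MR.mulN 2 (MR.mul p.1 p.1))) := by
      have h3 := Enc.one.sub (Enc.mulN 2 (h1.mul h1))
      have h4 : Real.cos (2 * θ) = 1 - ((2 : ℕ) : ℝ) * (Real.sin θ * Real.sin θ) := by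
        rw [Real.cos_two_mul, Real.cos_sq']; push_cast; ring
      rw [h4]; exact h3
    have h5 := ih (θ := 2 * θ) (MR.mulN 2 (MR.mul p.1 p.2),
      MR.sub MR.one (MR.mulN 2 (MR.mul p.1 p.1))) e1 e2
    have h6 : (2 : ℝ) ^ (n + 1) * θ = 2 ^ n * (2 * θ) := by ring
    rw [h6]
    exact h5

theorem sc_bound {t : ℝ} (ht : |t| ≤ 1 / 2) :
    |Real.sin t - t * hornerR (-(t * t)) [6,20,42,72,110]| ≤ 1 / 1000000000000 ∧
    |Real.cos t - hornerR (-(t * t)) [2,12,30,56,90]| ≤ 1 / 1000000000000 := by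
  have hn : ‖(t : ℂ) * Complex.I‖ ≤ 1 / 2 := by simpa using ht
  have hb := Complex.exp_bound (x := (t : ℂ) * Complex.I) (by linarith) (n := 12) (by norm_num)
  have hb2 : ‖Complex.exp ((t : ℂ) * Complex.I) - ∑ m ∈ Finset.range 12,
      ((t : ℂ) * Complex.I) ^ m / (m.factorial : ℂ)‖ ≤ 1 / 1000000000000 := by
    refine hb.trans ?_
    have hp : ‖(t : ℂ) * Complex.I‖ ^ 12 ≤ (1 / 2) ^ 12 := by gcongr
    refine (mul_le_mul_of_nonneg_right hp (by positivity)).trans ?_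
    norm_num [Nat.factorial]
  have e : Complex.exp ((t : ℂ) * Complex.I) - ∑ m ∈ Finset.range 12,
      ((t : ℂ) * Complex.I) ^ m / (m.factorial : ℂ) =
      ((Real.cos t - hornerR (-(t * t)) [2,12,30,56,90] : ℝ) : ℂ)
      + ((Real.sin t - t * hornerR (-(t * t)) [6,20,42,72,110] : ℝ) : ℂ) * Complex.I := by
    rw [Complex.exp_mul_I]
    have i2 : Complex.I ^ 2 = -1 := Complex.I_sq
    have i3 : Complex.I ^ 3 = -Complex.I := Complex.I_pow_three
    have i4 : Complex.I ^ 4 = 1 := Complex.I_pow_four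
    have i5 : Complex.I ^ 5 = Complex.I := by rw [pow_succ, i4, one_mul]
    have i6 : Complex.I ^ 6 = -1 := by rw [pow_succ, i5, ← sq, i2]
    have i7 : Complex.I ^ 7 = -Complex.I := by rw [pow_succ, i6]; ring
    have i8 : Complex.I ^ 8 = 1 := by rw [show 8 = 4 * 2 by rfl, pow_mul, i4, one_pow]
    have i9 : Complex.I ^ 9 = Complex.I := by rw [pow_succ, i8, one_mul]
    have i10 : Complex.I ^ 10 = -1 := by rw [pow_succ, i9, ← sq, i2]
    have i11 : Complex.I ^ 11 = -Complex.I := by rw [pow_succ, i10]; ring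
    simp only [Finset.sum_range_succ, Finset.sum_range_zero, mul_pow, i2, i3, i4, i5, i6, i7, i8,
      i9, i10, i11, hornerR]
    push_cast [Nat.factorial]
    ring
  rw [e] at hb2
  constructor
  · refine le_trans ?_ hb2
    refine le_trans (le_of_eq ?_) (Complex.abs_im_le_norm _)
    simp [-Complex.ofReal_sub, -Complex.ofReal_mul, -Complex.ofReal_sin, -Complex.ofReal_cos]
  · refine le_trans ?_ hb2
    refine le_trans (le_of_eq ?_) (Complex.abs_re_le_norm _)
    simp [-Complex.ofReal_sub, -Complex.ofReal_mul, -Complex.ofReal_sin, -Complex.ofReal_cos]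

theorem sc0 (m : ℤ) (h : m.natAbs ≤ 4398046511104) :
    Enc (Real.sin ((m : ℝ) / 1099511627776)) (MR.sc0 (MR.divN 8 ⟨m, 0⟩)).1 ∧
    Enc (Real.cos ((m : ℝ) / 1099511627776)) (MR.sc0 (MR.divN 8 ⟨m, 0⟩)).2 := by
  set x := (m : ℝ) / 1099511627776 with hx
  have hm : |(m : ℝ)| ≤ 4398046511104 := by
    rw [← Int.cast_abs, Int.abs_eq_natAbs]; exact_mod_cast h
  have ht : |x / 8| ≤ 1 / 2 := by
    rw [hx, abs_div, abs_div, abs_of_pos (by norm_num : (0 : ℝ) < 8),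
      abs_of_pos (by norm_num : (0 : ℝ) < 1099511627776)]
    rw [div_div, div_le_iff₀ (by norm_num)]
    linarith
  have h1 : Enc (x / 8) (MR.divN 8 ⟨m, 0⟩) := by
    have := (exact m).divN 8 (by norm_num)
    rw [Nat.cast_ofNat] at this
    exact this
  have hq := (h1.mul h1).neg
  have hb := sc_bound ht
  have hs : Enc (Real.sin (x / 8)) (MR.widen 4 (MR.mul (MR.divN 8 ⟨m, 0⟩)
      (MR.horner (MR.neg (MR.mul (MR.divN 8 ⟨m, 0⟩) (MR.divN 8 ⟨m, 0⟩))) [6,20,42,72,110]))) := by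
    refine (h1.mul (hq.horner _ (by simp))).widen ?_
    refine (mul_le_mul_of_nonneg_right hb.1 (by norm_num)).trans ?_
    norm_num
  have hc : Enc (Real.cos (x / 8)) (MR.widen 4
      (MR.horner (MR.neg (MR.mul (MR.divN 8 ⟨m, 0⟩) (MR.divN 8 ⟨m, 0⟩))) [2,12,30,56,90])) := by
    refine (hq.horner _ (by simp)).widen ?_
    refine (mul_le_mul_of_nonneg_right hb.2 (by norm_num)).trans ?_
    norm_num
  have := dbl 3 (_, _) hs hc
  unfold MR.sc0
  rwa [show (2 : ℝ) ^ 3 * (x / 8) = x by ring] at this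

theorem dist {x : ℝ} {a : MR} (ha : Enc x a) :
    |x - (a.m : ℝ) / 1099511627776| * 1099511627776 ≤ a.r := by
  unfold Enc at ha
  have h0 : (0 : ℝ) < 1099511627776 := by norm_num
  have e : x * 1099511627776 - a.m = (x - (a.m : ℝ) / 1099511627776) * 1099511627776 := by
    field_simp
  rwa [e, abs_mul, abs_of_pos h0] at ha

theorem sin {x : ℝ} {a : MR} (ha : Enc x a) (h : a.okSin = true) : Enc (Real.sin x) a.sin := by
  simp only [MR.okSin, Nat.ble_eq] at h
  refine (sc0 a.m h).1.widen ?_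
  exact (mul_le_mul_of_nonneg_right (Real.abs_sin_sub_sin_le _ _) (by norm_num)).trans ha.dist

theorem cos {x : ℝ} {a : MR} (ha : Enc x a) (h : a.okSin = true) : Enc (Real.cos x) a.cos := by
  simp only [MR.okSin, Nat.ble_eq] at h
  refine (sc0 a.m h).2.widen ?_
  exact (mul_le_mul_of_nonneg_right (Real.abs_cos_sub_cos_le _ _) (by norm_num)).trans ha.dist

theorem abs_le_mag {x : ℝ} {a : MR} (ha : Enc x a) : |x| * 1099511627776 ≤ a.mag := by
  unfold Enc at ha
  unfold MR.mag
  have h0 : (0 : ℝ) < 1099511627776 := by norm_num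
  rw [Nat.add_eq, Nat.cast_add, Nat.cast_natAbs, Int.cast_abs]
  calc |x| * 1099511627776 = |x * 1099511627776| := by rw [abs_mul, abs_of_pos h0]
    _ = |(a.m : ℝ) + (x * 1099511627776 - a.m)| := by ring_nf
    _ ≤ _ := (abs_add_le _ _).trans (by linarith)

end Enc

/-! ### Second order jets over a box -/

/-- Enclosures for a function and its first two derivatives, with a validity flag. -/
structure Jet where
  ok : Bool
  a : MR
  b : MR
  c : MR

namespace Jet
def add (s o : Jet) : Jet := ⟨and s.ok o.ok, s.a.add o.a, s.b.add o.b, s.c.add o.c⟩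
def neg (s : Jet) : Jet := ⟨s.ok, s.a.neg, s.b.neg, s.c.neg⟩
def sub (s o : Jet) : Jet := add s (neg o)
def mul (s o : Jet) : Jet := ⟨and s.ok o.ok, s.a.mul o.a, (s.a.mul o.b).add (s.b.mul o.a),
  ((s.a.mul o.c).add (s.c.mul o.a)).add (MR.mulN 2 (s.b.mul o.b))⟩
def smul (k : MR) (s : Jet) : Jet := ⟨s.ok, k.mul s.a, k.mul s.b, k.mul s.c⟩
def mulN (n : Nat) (s : Jet) : Jet := ⟨s.ok, s.a.mulN n, s.b.mulN n, s.c.mulN n⟩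
def divN (n : Nat) (s : Jet) : Jet := ⟨s.ok, s.a.divN n, s.b.divN n, s.c.divN n⟩
def addc (k : MR) (s : Jet) : Jet := ⟨s.ok, k.add s.a, s.b, s.c⟩
def comp (o : Bool) (f0 f1 f2 : MR) (u : Jet) : Jet :=
  ⟨and u.ok o, f0, f1.mul u.b, (f2.mul (u.b.mul u.b)).add (f1.mul u.c)⟩
def inv (u : Jet) : Jet :=
  comp u.a.pos u.a.inv (u.a.inv.mul u.a.inv).neg
    (MR.mulN 2 (u.a.inv.mul (u.a.inv.mul u.a.inv))) u
def exp (u : Jet) : Jet := comp u.a.okExp u.a.exp u.a.exp u.a.exp u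
def sin (u : Jet) : Jet := comp u.a.okSin u.a.sin u.a.cos u.a.sin.neg u
def cos (u : Jet) : Jet := comp u.a.okSin u.a.cos u.a.sin.neg u.a.cos.neg u
/-- The identity function near `m`, with radius `d`. -/
def var (m d : Nat) : Jet := ⟨true, ⟨Int.ofNat m, d⟩, MR.one, ⟨0, 0⟩⟩
end Jet

/-- `J` encloses `f` together with its first two derivatives on `s`. -/
def JE (f : ℝ → ℝ) (J : Jet) (s : Set ℝ) : Prop :=
  J.ok = true → ∃ f1 f2 : ℝ → ℝ, ∀ x ∈ s, HasDerivAt f (f1 x) x ∧ HasDerivAt f1 (f2 x) x ∧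
    Enc (f x) J.a ∧ Enc (f1 x) J.b ∧ Enc (f2 x) J.c

namespace JE
variable {f g : ℝ → ℝ} {F G : Jet} {s : Set ℝ}

theorem add (hf : JE f F s) (hg : JE g G s) : JE (fun x => f x + g x) (F.add G) s := by
  intro h
  have h' : F.ok = true ∧ G.ok = true := by simpa [Jet.add] using h
  obtain ⟨f1, f2, h1⟩ := hf h'.1
  obtain ⟨g1, g2, h2⟩ := hg h'.2
  refine ⟨fun x => f1 x + g1 x, fun x => f2 x + g2 x, fun x hx => ?_⟩
  obtain ⟨a1, a2, a3, a4, a5⟩ := h1 x hx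
  obtain ⟨b1, b2, b3, b4, b5⟩ := h2 x hx
  exact ⟨a1.add b1, a2.add b2, a3.add b3, a4.add b4, a5.add b5⟩

theorem neg (hf : JE f F s) : JE (fun x => - f x) F.neg s := by
  intro h
  obtain ⟨f1, f2, h1⟩ := hf h
  refine ⟨fun x => - f1 x, fun x => - f2 x, fun x hx => ?_⟩
  obtain ⟨a1, a2, a3, a4, a5⟩ := h1 x hx
  exact ⟨a1.neg, a2.neg, a3.neg, a4.neg, a5.neg⟩

theorem congr (hf : JE f F s) (h : ∀ x, f x = g x) : JE g F s := by
  have : f = g := funext h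
  rwa [← this]

theorem sub (hf : JE f F s) (hg : JE g G s) : JE (fun x => f x - g x) (F.sub G) s :=
  (hf.add hg.neg).congr (fun x => by ring)

theorem mul (hf : JE f F s) (hg : JE g G s) : JE (fun x => f x * g x) (F.mul G) s := by
  intro h
  have h' : F.ok = true ∧ G.ok = true := by simpa [Jet.mul] using h
  obtain ⟨f1, f2, h1⟩ := hf h'.1
  obtain ⟨g1, g2, h2⟩ := hg h'.2
  refine ⟨fun x => f x * g1 x + f1 x * g x,
    fun x => (f x * g2 x + f2 x * g x) + ((2 : ℕ) : ℝ) * (f1 x * g1 x), fun x hx => ?_⟩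
  obtain ⟨a1, a2, a3, a4, a5⟩ := h1 x hx
  obtain ⟨b1, b2, b3, b4, b5⟩ := h2 x hx
  refine ⟨?_, ?_, a3.mul b3, (a3.mul b4).add (a4.mul b3),
    ((a3.mul b5).add (a5.mul b3)).add (Enc.mulN 2 (a4.mul b4))⟩
  · exact (a1.mul b1).congr_deriv (by ring)
  · exact ((a1.mul b2).add (a2.mul b1)).congr_deriv (by push_cast; ring)

theorem smul {k : ℝ} {K : MR} (hk : Enc k K) (hf : JE f F s) :
    JE (fun x => k * f x) (F.smul K) s := by
  intro h
  obtain ⟨f1, f2, h1⟩ := hf h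
  refine ⟨fun x => k * f1 x, fun x => k * f2 x, fun x hx => ?_⟩
  obtain ⟨a1, a2, a3, a4, a5⟩ := h1 x hx
  exact ⟨a1.const_mul k, a2.const_mul k, hk.mul a3, hk.mul a4, hk.mul a5⟩

theorem mulN (n : ℕ) (hf : JE f F s) : JE (fun x => n * f x) (F.mulN n) s := by
  intro h
  obtain ⟨f1, f2, h1⟩ := hf h
  refine ⟨fun x => n * f1 x, fun x => n * f2 x, fun x hx => ?_⟩
  obtain ⟨a1, a2, a3, a4, a5⟩ := h1 x hx
  exact ⟨a1.const_mul _, a2.const_mul _, a3.mulN n, a4.mulN n, a5.mulN n⟩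

theorem divN (n : ℕ) (hn : 0 < n) (hf : JE f F s) : JE (fun x => f x / n) (F.divN n) s := by
  intro h
  obtain ⟨f1, f2, h1⟩ := hf h
  refine ⟨fun x => f1 x / n, fun x => f2 x / n, fun x hx => ?_⟩
  obtain ⟨a1, a2, a3, a4, a5⟩ := h1 x hx
  exact ⟨a1.div_const _, a2.div_const _, a3.divN n hn, a4.divN n hn, a5.divN n hn⟩

theorem addc {k : ℝ} {K : MR} (hk : Enc k K) (hf : JE f F s) :
    JE (fun x => k + f x) (F.addc K) s := by
  intro h
  obtain ⟨f1, f2, h1⟩ := hf h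
  refine ⟨f1, f2, fun x hx => ?_⟩
  obtain ⟨a1, a2, a3, a4, a5⟩ := h1 x hx
  exact ⟨a1.const_add k, a2, hk.add a3, a4, a5⟩

theorem comp {φ φ1 φ2 : ℝ → ℝ} {o : Bool} {f0 f1' f2' : MR} (hf : JE f F s)
    (h : o = true → ∀ y, Enc y F.a → HasDerivAt φ (φ1 y) y ∧ HasDerivAt φ1 (φ2 y) y ∧
      Enc (φ y) f0 ∧ Enc (φ1 y) f1' ∧ Enc (φ2 y) f2') :
    JE (fun x => φ (f x)) (F.comp o f0 f1' f2') s := by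
  intro hh
  have h' : F.ok = true ∧ o = true := by simpa [Jet.comp] using hh
  obtain ⟨f1, f2, h1⟩ := hf h'.1
  refine ⟨fun x => φ1 (f x) * f1 x, fun x => φ2 (f x) * (f1 x * f1 x) + φ1 (f x) * f2 x,
    fun x hx => ?_⟩
  obtain ⟨a1, a2, a3, a4, a5⟩ := h1 x hx
  obtain ⟨b1, b2, b3, b4, b5⟩ := h h'.2 _ a3
  refine ⟨b1.comp x a1, ?_, b3, b4.mul a4, (b5.mul (a4.mul a4)).add (b4.mul a5)⟩
  exact ((b2.comp x a1).mul a2).congr_deriv (by simp only [Function.comp]; ring)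

theorem inv (hf : JE f F s) : JE (fun x => (f x)⁻¹) F.inv s := by
  refine comp (φ := fun y => y⁻¹) (φ1 := fun y => -(y⁻¹ * y⁻¹))
    (φ2 := fun y => ((2 : ℕ) : ℝ) * (y⁻¹ * (y⁻¹ * y⁻¹))) hf ?_
  intro ho y hy
  have hy0 := (hy.pos ho).ne'
  have hi := hy.inv ho
  have hd : HasDerivAt (fun y : ℝ => y⁻¹) (-(y⁻¹ * y⁻¹)) y :=
    (hasDerivAt_inv hy0).congr_deriv (by rw [sq, mul_inv])
  refine ⟨hd, ?_, hi, (hi.mul hi).neg, Enc.mulN 2 (hi.mul (hi.mul hi))⟩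
  exact (hd.mul hd).neg.congr_deriv (by push_cast; ring)

theorem exp (hf : JE f F s) : JE (fun x => Real.exp (f x)) F.exp s := by
  refine comp (φ := Real.exp) (φ1 := Real.exp) (φ2 := Real.exp) hf ?_
  intro ho y hy
  exact ⟨Real.hasDerivAt_exp y, Real.hasDerivAt_exp y, hy.exp ho, hy.exp ho, hy.exp ho⟩

theorem sin (hf : JE f F s) : JE (fun x => Real.sin (f x)) F.sin s := by
  refine comp (φ := Real.sin) (φ1 := Real.cos) (φ2 := fun y => - Real.sin y) hf ?_
  intro ho y hy
  exact ⟨Real.hasDerivAt_sin y, Real.hasDerivAt_cos y, hy.sin ho, hy.cos ho, (hy.sin ho).neg⟩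

theorem cos (hf : JE f F s) : JE (fun x => Real.cos (f x)) F.cos s := by
  refine comp (φ := Real.cos) (φ1 := fun y => - Real.sin y) (φ2 := fun y => - Real.cos y) hf ?_
  intro ho y hy
  exact ⟨Real.hasDerivAt_cos y, (Real.hasDerivAt_sin y).neg, hy.cos ho, (hy.sin ho).neg,
    (hy.cos ho).neg⟩

theorem var (m d : ℕ) : JE (fun x => x) (Jet.var m d) {x | Enc x ⟨m, d⟩} := by
  intro _
  exact ⟨fun _ => 1, fun _ => 0, fun x hx => ⟨hasDerivAt_id x, hasDerivAt_const x 1, hx, Enc.one,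
    Enc.zero 0⟩⟩

end JE

/-! ### Midpoint rule -/

theorem taylor_two {f f1 f2 : ℝ → ℝ} {s : Set ℝ} (hs : s.OrdConnected)
    (h1 : ∀ x ∈ s, HasDerivAt f (f1 x) x) (h2 : ∀ x ∈ s, HasDerivAt f1 (f2 x) x)
    {m x : ℝ} (hm : m ∈ s) (hx : x ∈ s) :
    ∃ y ∈ s, f x = f m + f1 m * (x - m) + f2 y / 2 * (x - m) ^ 2 := by
  have hG : ∀ y ∈ s, HasDerivAt (fun y => f y - f1 m * (y - m)) (f1 y - f1 m) y := fun y hy => by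
    exact ((h1 y hy).sub (((hasDerivAt_id y).sub_const m).const_mul (f1 m))).congr_deriv (by ring)
  have hQ : ∀ y, HasDerivAt (fun y : ℝ => (y - m) ^ 2) (2 * (y - m)) y := fun y => by
    exact (((hasDerivAt_id y).sub_const m).pow 2).congr_deriv (by simp)
  rcases lt_trichotomy m x with hlt | rfl | hlt
  · have hsub : Set.Icc m x ⊆ s := hs.out hm hx
    obtain ⟨c, hc, e⟩ := exists_ratio_hasDerivAt_eq_ratio_slope (fun y => f y - f1 m * (y - m))
      (fun y => f1 y - f1 m) hlt
      (fun y hy => (hG y (hsub hy)).continuousAt.continuousWithinAt)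
      (fun y hy => hG y (hsub (Set.Ioo_subset_Icc_self hy)))
      (fun y => (y - m) ^ 2) (fun y => 2 * (y - m))
      (fun y _ => (hQ y).continuousAt.continuousWithinAt) (fun y _ => hQ y)
    have hcs : Set.Icc m c ⊆ s := hs.out hm (hsub (Set.Ioo_subset_Icc_self hc))
    obtain ⟨y, hy, e2⟩ := exists_hasDerivAt_eq_slope f1 f2 hc.1
      (fun y hy => (h2 y (hcs hy)).continuousAt.continuousWithinAt)
      (fun y hy => h2 y (hcs (Set.Ioo_subset_Icc_self hy)))
    refine ⟨y, hcs (Set.Ioo_subset_Icc_self hy), ?_⟩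
    have hcm : c - m ≠ 0 := sub_ne_zero.mpr hc.1.ne'
    rw [eq_div_iff hcm] at e2
    rw [← e2] at e
    have : (c - m) * (f x - (f m + f1 m * (x - m) + f2 y / 2 * (x - m) ^ 2)) = 0 := by
      linear_combination (-1 / 2) * e
    rcases mul_eq_zero.mp this with h | h
    · exact absurd h hcm
    · linarith
  · exact ⟨m, hm, by ring⟩
  · have hsub : Set.Icc x m ⊆ s := hs.out hx hm
    obtain ⟨c, hc, e⟩ := exists_ratio_hasDerivAt_eq_ratio_slope (fun y => f y - f1 m * (y - m))
      (fun y => f1 y - f1 m) hlt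
      (fun y hy => (hG y (hsub hy)).continuousAt.continuousWithinAt)
      (fun y hy => hG y (hsub (Set.Ioo_subset_Icc_self hy)))
      (fun y => (y - m) ^ 2) (fun y => 2 * (y - m))
      (fun y _ => (hQ y).continuousAt.continuousWithinAt) (fun y _ => hQ y)
    have hcs : Set.Icc c m ⊆ s := hs.out (hsub (Set.Ioo_subset_Icc_self hc)) hm
    obtain ⟨y, hy, e2⟩ := exists_hasDerivAt_eq_slope f1 f2 hc.2
      (fun y hy => (h2 y (hcs hy)).continuousAt.continuousWithinAt)
      (fun y hy => h2 y (hcs (Set.Ioo_subset_Icc_self hy)))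
    refine ⟨y, hcs (Set.Ioo_subset_Icc_self hy), ?_⟩
    have hcm : m - c ≠ 0 := sub_ne_zero.mpr hc.2.ne'
    rw [eq_div_iff hcm] at e2
    have e3 : f1 c - f1 m = - (f2 y * (m - c)) := by rw [e2]; ring
    rw [e3] at e
    have : (m - c) * (f x - (f m + f1 m * (x - m) + f2 y / 2 * (x - m) ^ 2)) = 0 := by
      linear_combination (-1 / 2) * e
    rcases mul_eq_zero.mp this with h | h
    · exact absurd h hcm
    · linarith

theorem midpoint_rule {f f1 f2 : ℝ → ℝ} {m d lo hi : ℝ} (hd : 0 < d)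
    (h1 : ∀ x ∈ Set.Icc (m - d) (m + d), HasDerivAt f (f1 x) x)
    (h2 : ∀ x ∈ Set.Icc (m - d) (m + d), HasDerivAt f1 (f2 x) x)
    (h3 : ∀ x ∈ Set.Icc (m - d) (m + d), lo ≤ f2 x ∧ f2 x ≤ hi) :
    2 * d * f m + lo * (d ^ 3 / 3) ≤ ∫ x in (m - d)..(m + d), f x ∧
    ∫ x in (m - d)..(m + d), f x ≤ 2 * d * f m + hi * (d ^ 3 / 3) := by
  have hle : m - d ≤ m + d := by linarith
  have hm : m ∈ Set.Icc (m - d) (m + d) := ⟨by linarith, by linarith⟩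
  have hi0 : ∀ k : ℝ, ∫ x in (m - d)..(m + d), (f m + f1 m * (x - m) + k / 2 * (x - m) ^ 2)
      = 2 * d * f m + k * (d ^ 3 / 3) := by
    intro k
    have hderiv : ∀ x ∈ Set.uIcc (m - d) (m + d), HasDerivAt
        (fun x => f m * (x - m) + f1 m * (x - m) ^ 2 / 2 + k / 6 * (x - m) ^ 3)
        (f m + f1 m * (x - m) + k / 2 * (x - m) ^ 2) x := by
      intro x _
      have e := (hasDerivAt_id x).sub_const m
      have := ((e.const_mul (f m)).add (((e.pow 2).const_mul (f1 m)).div_const 2)).add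
        ((e.pow 3).const_mul (k / 6))
      refine (this.congr_deriv ?_)
      simp only [id]
      push_cast
      ring
    rw [intervalIntegral.integral_eq_sub_of_hasDerivAt hderiv
      (Continuous.intervalIntegrable (by fun_prop) _ _)]
    ring
  have hfi : IntervalIntegrable f volume (m - d) (m + d) := by
    apply ContinuousOn.intervalIntegrable
    rw [Set.uIcc_of_le hle]
    exact fun x hx => (h1 x hx).continuousAt.continuousWithinAt
  rw [← hi0 lo, ← hi0 hi]
  constructor
  · refine intervalIntegral.integral_mono_on hle (Continuous.intervalIntegrable (by fun_prop) _ _)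
      hfi fun x hx => ?_
    obtain ⟨y, hy, e⟩ := taylor_two Set.ordConnected_Icc h1 h2 hm hx
    rw [e]
    have := (h3 y hy).1
    gcongr
  · refine intervalIntegral.integral_mono_on hle hfi
      (Continuous.intervalIntegrable (by fun_prop) _ _) fun x hx => ?_
    obtain ⟨y, hy, e⟩ := taylor_two Set.ordConnected_Icc h1 h2 hm hx
    rw [e]
    have := (h3 y hy).2
    gcongr

/-- Grid points in units of `2 ^ (-40)`. -/
noncomputable def gp (m : ℕ) : ℝ := (m : ℝ) / 1099511627776

theorem enc_box {m d : ℕ} {x : ℝ} : Enc x ⟨m, d⟩ ↔ x ∈ Set.Icc (gp m - gp d) (gp m + gp d) := by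
  unfold Enc gp
  rw [abs_le, Set.mem_Icc, ← sub_div, ← add_div, div_le_iff₀ (by norm_num), le_div_iff₀ (by norm_num)]
  push_cast
  constructor <;> rintro ⟨h1, h2⟩ <;> constructor <;> linarith

/-- One panel of the midpoint rule. -/
def panel (F : Jet → Jet) (m d : Nat) : Bool × MR :=
  (and (F (Jet.var m d)).ok (F (Jet.var m 0)).ok,
    ((MR.mulN 2 ⟨Int.ofNat d, 0⟩).mul (F (Jet.var m 0)).a).add ((F (Jet.var m d)).c.mul
      (MR.divN 3 (MR.mul ⟨Int.ofNat d, 0⟩ (MR.mul ⟨Int.ofNat d, 0⟩ ⟨Int.ofNat d, 0⟩)))))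

/-- The jet map `F` is correct for `f`. -/
def JMap (f : ℝ → ℝ) (F : Jet → Jet) : Prop :=
  ∀ J s, JE (fun x => x) J s → JE f (F J) s

theorem JMap.panel {f : ℝ → ℝ} {F : Jet → Jet} (hF : JMap f F) {m d : ℕ} (hd : 0 < d)
    (hok : (panel F m d).1 = true) :
    IntervalIntegrable f volume (gp m - gp d) (gp m + gp d) ∧
    Enc (∫ x in (gp m - gp d)..(gp m + gp d), f x) (_root_.panel F m d).2 := by
  have h' : (F (Jet.var m d)).ok = true ∧ (F (Jet.var m 0)).ok = true := by
    simpa [_root_.panel] using hok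
  obtain ⟨f1, f2, hb⟩ := hF _ _ (JE.var m d) h'.1
  obtain ⟨g1, g2, hc⟩ := hF _ _ (JE.var m 0) h'.2
  have hd0 : 0 < gp d := by unfold gp; positivity
  have hdE : Enc (gp d) ⟨Int.ofNat d, 0⟩ := by
    have := Enc.exact (Int.ofNat d)
    simpa [gp] using this
  have hmE : Enc (gp m) ⟨m, 0⟩ := by
    have := Enc.exact (Int.ofNat m)
    simpa [gp] using this
  have hv := (hc (gp m) hmE).2.2.1
  have hset : ∀ x ∈ Set.Icc (gp m - gp d) (gp m + gp d), x ∈ {x | Enc x ⟨m, d⟩} :=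
    fun x hx => enc_box.mpr hx
  set C := (F (Jet.var m d)).c with hC
  have hI := midpoint_rule (f := f) (f1 := f1) (f2 := f2) (m := gp m) (d := gp d)
    (lo := (C.m - C.r) / 1099511627776) (hi := (C.m + C.r) / 1099511627776) hd0
    (fun x hx => (hb x (hset x hx)).1) (fun x hx => (hb x (hset x hx)).2.1) (fun x hx => by
      have := (hb x (hset x hx)).2.2.2.2
      unfold Enc at this
      rw [abs_le] at this
      rw [div_le_iff₀ (by norm_num), le_div_iff₀ (by norm_num)]
      constructor <;> linarith [this.1, this.2])
  refine ⟨?_, ?_⟩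
  · apply ContinuousOn.intervalIntegrable
    rw [Set.uIcc_of_le (by linarith)]
    exact fun x hx => (hb x (hset x hx)).1.continuousAt.continuousWithinAt
  set I := ∫ x in (gp m - gp d)..(gp m + gp d), f x with hIdef
  have hd3 : 0 < gp d ^ 3 / 3 := by positivity
  have hcE : Enc ((I - 2 * gp d * f (gp m)) / (gp d ^ 3 / 3)) C := by
    unfold Enc
    have l1 : (C.m - C.r) / 1099511627776 ≤ (I - 2 * gp d * f (gp m)) / (gp d ^ 3 / 3) := by
      rw [le_div_iff₀ hd3]; linarith [hI.1]
    have l2 : (I - 2 * gp d * f (gp m)) / (gp d ^ 3 / 3) ≤ (C.m + C.r) / 1099511627776 := by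
      rw [div_le_iff₀ hd3]; linarith [hI.2]
    rw [div_le_iff₀ (by norm_num)] at l1
    rw [le_div_iff₀ (by norm_num)] at l2
    rw [abs_le]
    constructor <;> linarith
  have := ((Enc.mulN 2 hdE).mul hv).add (hcE.mul ((hdE.mul (hdE.mul hdE)).divN 3 (by norm_num)))
  unfold _root_.panel
  convert this using 1
  push_cast
  field_simp
  ring

/-- Consecutive panels starting at `l`, `k` panels of half width `d` for each `(k, d)`. -/
def loop (F : Jet → Jet) : Nat → Nat → Nat → Bool × MR → Bool × MR
  | 0, _, _, acc => acc
  | k+1, l, d, acc =>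
    loop F k (Nat.add l (Nat.mul 2 d)) d
      (and acc.1 (panel F (Nat.add l d) d).1, acc.2.add (panel F (Nat.add l d) d).2)

theorem loop_fst (F : Jet → Jet) : ∀ k l d acc, (loop F k l d acc).1 = true → acc.1 = true
  | 0, _, _, _, h => h
  | k+1, l, d, acc, h => by
    have := loop_fst F k _ _ _ h
    simp only [Bool.and_eq_true] at this
    exact this.1

theorem JMap.loop {f : ℝ → ℝ} {F : Jet → Jet} (hF : JMap f F) (l0 d : ℕ) (hd : 0 < d) :
    ∀ (k l : ℕ) (acc : Bool × MR), IntervalIntegrable f volume (gp l0) (gp l) →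
      Enc (∫ x in (gp l0)..(gp l), f x) acc.2 → (_root_.loop F k l d acc).1 = true →
      IntervalIntegrable f volume (gp l0) (gp (l + k * (2 * d))) ∧
      Enc (∫ x in (gp l0)..(gp (l + k * (2 * d))), f x) (_root_.loop F k l d acc).2
  | 0, l, acc, h1, h2, _ => by simpa [_root_.loop] using And.intro h1 h2
  | k+1, l, acc, h1, h2, hok => by
    have h3 := loop_fst F k _ _ _ hok
    simp only [Bool.and_eq_true] at h3
    obtain ⟨p1, p2⟩ := hF.panel hd h3.2
    have e1 : gp (Nat.add l d) - gp d = gp l := by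
      unfold gp; push_cast [Nat.add_eq]; ring
    have e2 : gp (Nat.add l d) + gp d = gp (l + 2 * d) := by
      unfold gp; push_cast [Nat.add_eq]; ring
    rw [e1, e2] at p1 p2
    have h4 := hF.loop l0 d hd k (l + 2 * d) _ (h1.trans p1)
      (by rw [← intervalIntegral.integral_add_adjacent_intervals h1 p1]; exact h2.add p2) hok
    rw [show l + (k + 1) * (2 * d) = l + 2 * d + k * (2 * d) by ring]
    exact h4

/-- Run over a list of segments `(k, d)`. -/
def segs (F : Jet → Jet) : List (Nat × Nat) → Nat → Bool × MR → Bool × MR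
  | [], _, acc => acc
  | p :: t, l, acc => segs F t (Nat.add l (Nat.mul p.1 (Nat.mul 2 p.2))) (loop F p.1 l p.2 acc)

def segEnd : List (Nat × Nat) → Nat → Nat
  | [], l => l
  | p :: t, l => segEnd t (Nat.add l (Nat.mul p.1 (Nat.mul 2 p.2)))

theorem segs_fst (F : Jet → Jet) : ∀ L l acc, (segs F L l acc).1 = true → acc.1 = true
  | [], _, _, h => h
  | p :: t, l, acc, h => loop_fst F _ _ _ _ (segs_fst F t _ _ h)

theorem JMap.segs {f : ℝ → ℝ} {F : Jet → Jet} (hF : JMap f F) (l0 : ℕ) :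
    ∀ (L : List (ℕ × ℕ)) (l : ℕ) (acc : Bool × MR), (∀ p ∈ L, 0 < p.2) →
      IntervalIntegrable f volume (gp l0) (gp l) →
      Enc (∫ x in (gp l0)..(gp l), f x) acc.2 → (_root_.segs F L l acc).1 = true →
      IntervalIntegrable f volume (gp l0) (gp (segEnd L l)) ∧
      Enc (∫ x in (gp l0)..(gp (segEnd L l)), f x) (_root_.segs F L l acc).2
  | [], l, acc, _, h1, h2, _ => ⟨h1, h2⟩
  | p :: t, l, acc, hL, h1, h2, hok => by
    have h3 := segs_fst F t _ _ hok
    obtain ⟨q1, q2⟩ := hF.loop l0 p.2 (hL p (by simp)) p.1 l acc h1 h2 h3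
    exact hF.segs l0 t _ _ (fun q hq => hL q (by simp [hq])) q1 q2 hok

/-- The starting accumulator. -/
def acc0 : Bool × MR := (true, ⟨0, 0⟩)

theorem JMap.run {f : ℝ → ℝ} {F : Jet → Jet} (hF : JMap f F) (l : ℕ) (L : List (ℕ × ℕ))
    (hL : ∀ p ∈ L, 0 < p.2) (hok : (_root_.segs F L l acc0).1 = true) :
    IntervalIntegrable f volume (gp l) (gp (segEnd L l)) ∧
      Enc (∫ x in (gp l)..(gp (segEnd L l)), f x) (_root_.segs F L l acc0).2 :=
  hF.segs l L l acc0 hL IntervalIntegrable.refl (by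
    rw [intervalIntegral.integral_same]; exact Enc.zero 0) hok

/-! ### The concrete integrands -/

noncomputable def rE (β : ℝ) : ℝ := Real.exp (-(β * β / (10000 : ℕ)))
noncomputable def rZ (β : ℝ) : ℝ := β - Real.sin β * rE β
noncomputable def rP (β : ℝ) : ℝ :=
  1 + (β * (Real.sin β * rE β) / (5000 : ℕ) - Real.cos β * rE β)
noncomputable def rS (β : ℝ) : ℝ := (Real.exp (rZ β) - Real.exp (-(rZ β))) / (2 : ℕ)
noncomputable def rG (β : ℝ) : ℝ :=
  Real.exp (-(((2 : ℕ) * 1 + β) * ((2 : ℕ) * 1 + β))) +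
    Real.exp (-((-((2 : ℕ) * 1) + β) * (-((2 : ℕ) * 1) + β)))
noncomputable def rW (β : ℝ) : ℝ :=
  (3 / π) * ((Real.sin β - (4 : ℕ) * (Real.sin β * (Real.sin β * Real.sin β)) / (3 : ℕ)) -
    (2 : ℕ) * (Real.sin β * rG β) / (5 : ℕ))

def jE (b : Jet) : Jet := (((b.mul b).divN 10000).neg).exp
def jZ (b : Jet) : Jet := b.sub (b.sin.mul (jE b))
def jP (b : Jet) : Jet :=
  Jet.addc MR.one (((b.mul (b.sin.mul (jE b))).divN 5000).sub (b.cos.mul (jE b)))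
def jS (b : Jet) : Jet := ((jZ b).exp.sub ((jZ b).neg.exp)).divN 2
def jG (b : Jet) : Jet :=
  (((b.addc (MR.mulN 2 MR.one)).mul (b.addc (MR.mulN 2 MR.one))).neg.exp).add
    (((b.addc (MR.mulN 2 MR.one).neg).mul (b.addc (MR.mulN 2 MR.one).neg)).neg.exp)
def tpi : MR := ⟨Int.ofNat 1049956263285, 2⟩
def mpi : MR := ⟨Int.ofNat 3454217652358, 2⟩
def jW (b : Jet) : Jet :=
  Jet.smul tpi ((b.sin.sub ((Jet.mulN 4 (b.sin.mul (b.sin.mul b.sin))).divN 3)).sub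
    ((Jet.mulN 2 (b.sin.mul (jG b))).divN 5))

theorem enc_pi : Enc π mpi := by
  unfold Enc mpi
  have h1 := Real.pi_gt_d20
  have h2 := Real.pi_lt_d20
  rw [abs_le]
  push_cast
  norm_num at h1 h2 ⊢
  constructor <;> linarith

theorem enc_tpi : Enc (3 / π) tpi := by
  unfold Enc tpi
  have h1 := Real.pi_gt_d20
  have h2 := Real.pi_lt_d20
  have hp := Real.pi_pos
  have e : 3 / π * 1099511627776 = 3298534883328 / π := by ring
  rw [e, abs_le]
  push_cast
  norm_num at h1 h2 ⊢
  constructor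
  · rw [← sub_le_iff_le_add, le_div_iff₀ hp]; linarith
  · rw [div_le_iff₀ hp]; linarith

theorem jmap_E : JMap rE jE := fun _ _ h => ((h.mul h).divN 10000 (by norm_num)).neg.exp
theorem jmap_Z : JMap rZ jZ := fun J s h => h.sub (h.sin.mul (jmap_E J s h))
theorem jmap_P : JMap rP jP := fun J s h =>
  JE.addc Enc.one (((h.mul (h.sin.mul (jmap_E J s h))).divN 5000 (by norm_num)).sub
    (h.cos.mul (jmap_E J s h)))
theorem jmap_S : JMap rS jS := fun J s h =>
  ((jmap_Z J s h).exp.sub (jmap_Z J s h).neg.exp).divN 2 (by norm_num)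
theorem jmap_G : JMap rG jG := fun J s h =>
  (((h.addc (Enc.mulN 2 Enc.one)).mul (h.addc (Enc.mulN 2 Enc.one))).neg.exp).add
    (((h.addc (Enc.mulN 2 Enc.one).neg).mul (h.addc (Enc.mulN 2 Enc.one).neg)).neg.exp)
theorem jmap_W : JMap rW jW := fun J s h =>
  JE.smul enc_tpi ((h.sin.sub ((JE.mulN 4 (h.sin.mul (h.sin.mul h.sin))).divN 3 (by norm_num))).sub
    ((JE.mulN 2 (h.sin.mul (jmap_G J s h))).divN 5 (by norm_num)))

/-- The integrand of the first integral. -/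
noncomputable def rF (h β : ℝ) : ℝ :=
  (2 : ℕ) * (rP β * rS β * Real.sin (h * rW β) *
    (((2 : ℕ) * 1 + (rS β * rS β - Real.sin (h * rW β) * Real.sin (h * rW β))) *
      ((rS β * rS β + Real.sin (h * rW β) * Real.sin (h * rW β))⁻¹ *
        (rS β * rS β + Real.sin (h * rW β) * Real.sin (h * rW β))⁻¹)))

def jF1 (p S s : Jet) : Jet :=
  Jet.mulN 2 (((p.mul S).mul s).mul
    ((((S.mul S).sub (s.mul s)).addc (MR.mulN 2 MR.one)).mul
      (((S.mul S).add (s.mul s)).inv.mul ((S.mul S).add (s.mul s)).inv)))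
def jF (H : MR) (b : Jet) : Jet := jF1 (jP b) (jS b) ((jW b).smul H).sin

theorem jmap_F {h : ℝ} {H : MR} (hH : Enc h H) : JMap (rF h) (jF H) := fun J s hJ => by
  have p := jmap_P J s hJ
  have S := jmap_S J s hJ
  have t := ((jmap_W J s hJ).smul hH).sin
  exact JE.mulN 2 (((p.mul S).mul t).mul
    ((JE.addc (Enc.mulN 2 Enc.one) ((S.mul S).sub (t.mul t))).mul
      (((S.mul S).add (t.mul t)).inv.mul ((S.mul S).add (t.mul t)).inv)))

/-- The two kernels of the second integral. -/
noncomputable def rT (l a c : ℝ) : ℝ :=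
  (l - c) * (((l - c) * (l - c) + a * a)⁻¹ * ((l - c) * (l - c) + a * a)⁻¹) -
    (l + c) * (((l + c) * (l + c) + a * a)⁻¹ * ((l + c) * (l + c) + a * a)⁻¹)
noncomputable def rU (l a c : ℝ) : ℝ :=
  ((l - c) * (l - c) + a * a)⁻¹ - ((l + c) * (l + c) + a * a)⁻¹
noncomputable def rV (h β : ℝ) : ℝ :=
  rP β * rZ β * ((rT ((2 : ℕ) * h) (rZ β) (h * rW β) + rT π (rZ β) (h * rW β)) -
    (Real.cos h * (Real.sin h)⁻¹) * (rU π (rZ β) (h * rW β) -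
      rU (π + (2 : ℕ) * h) (rZ β) (h * rW β)))

def jD (l a : Jet) : Jet := ((l.mul l).add (a.mul a)).inv
def jT (l : MR) (a c : Jet) : Jet :=
  ((c.neg.addc l).mul ((jD (c.neg.addc l) a).mul (jD (c.neg.addc l) a))).sub
    ((c.addc l).mul ((jD (c.addc l) a).mul (jD (c.addc l) a)))
def jU (l : MR) (a c : Jet) : Jet := (jD (c.neg.addc l) a).sub (jD (c.addc l) a)
def jV1 (H : MR) (p a c : Jet) : Jet :=
  (p.mul a).mul (((jT (MR.mulN 2 H) a c).add (jT mpi a c)).sub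
    (Jet.smul (H.cos.mul H.sin.inv) ((jU mpi a c).sub (jU (mpi.add (MR.mulN 2 H)) a c))))
def jV (H : MR) (b : Jet) : Jet := jV1 H (jP b) (jZ b) ((jW b).smul H)

section
variable {a c : ℝ → ℝ} {A C : Jet} {s : Set ℝ} {l : ℝ} {L : MR}
theorem je_T (hl : Enc l L) (ha : JE a A s) (hc : JE c C s) :
    JE (fun x => rT l (a x) (c x)) (jT L A C) s := by
  have m := JE.addc hl hc.neg
  have p := JE.addc hl hc
  have dm := ((m.mul m).add (ha.mul ha)).inv
  have dp := ((p.mul p).add (ha.mul ha)).inv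
  exact (((m.mul (dm.mul dm)).sub (p.mul (dp.mul dp)))).congr (fun x => by
    simp only [rT, sub_eq_add_neg])
theorem je_U (hl : Enc l L) (ha : JE a A s) (hc : JE c C s) :
    JE (fun x => rU l (a x) (c x)) (jU L A C) s := by
  have m := JE.addc hl hc.neg
  have p := JE.addc hl hc
  have dm := ((m.mul m).add (ha.mul ha)).inv
  have dp := ((p.mul p).add (ha.mul ha)).inv
  exact (dm.sub dp).congr (fun x => by simp only [rU, sub_eq_add_neg])
end

theorem jmap_V {h : ℝ} {H : MR} (hH : Enc h H) (h1 : H.okSin = true) (h2 : H.sin.pos = true) :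
    JMap (rV h) (jV H) := fun J s hJ => by
  have p := jmap_P J s hJ
  have a := jmap_Z J s hJ
  have c := (jmap_W J s hJ).smul hH
  have h2' := Enc.mulN 2 hH
  exact (p.mul a).mul (((je_T h2' a c).add (je_T enc_pi a c)).sub
    (JE.smul ((hH.cos h1).mul ((hH.sin h1).inv h2)) ((je_U enc_pi a c).sub
      (je_U (enc_pi.add h2') a c))))

/-- The weight for the error terms. -/
noncomputable def rM (β : ℝ) : ℝ := rP β * rZ β * rW β
def jM (b : Jet) : Jet := ((jP b).mul (jZ b)).mul (jW b)
theorem jmap_M : JMap rM jM := fun J s h => ((jmap_P J s h).mul (jmap_Z J s h)).mul (jmap_W J s h)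

/-! ### Numerical checks -/

/-- The flag holds and the ball is contained in the ball `B`. -/
def inB (p : Bool × MR) (B : MR) : Bool :=
  and p.1 (Nat.ble (Nat.add (Int.natAbs (Int.sub p.2.m B.m)) p.2.r) B.r)

theorem inB_fst {p : Bool × MR} {B : MR} (h : inB p B = true) : p.1 = true := by
  simp only [inB, Bool.and_eq_true] at h
  exact h.1

theorem inB_enc {p : Bool × MR} {B : MR} {x : ℝ} (h : inB p B = true) (hx : Enc x p.2) :
    Enc x B := by
  simp only [inB, Bool.and_eq_true, Nat.ble_eq, Nat.add_eq] at h
  have h2 : ((Int.natAbs (p.2.m - B.m) + p.2.r : ℕ) : ℝ) ≤ B.r := by exact_mod_cast h.2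
  push_cast [Nat.cast_natAbs] at h2
  unfold Enc at *
  calc |x * 1099511627776 - B.m|
      = |(x * 1099511627776 - p.2.m) + (p.2.m - B.m)| := by ring_nf
    _ ≤ |x * 1099511627776 - p.2.m| + |(p.2.m : ℝ) - B.m| := abs_add_le _ _
    _ ≤ _ := by linarith

/-- Consecutive runs with prescribed enclosures. -/
def Chain (F : Jet → Jet) : ℕ → List (List (ℕ × ℕ) × MR) → Prop
  | _, [] => True
  | l, c :: t => inB (segs F c.1 l acc0) c.2 = true ∧ Chain F (segEnd c.1 l) t

def chainEnd : ℕ → List (List (ℕ × ℕ) × MR) → ℕ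
  | l, [] => l
  | l, c :: t => chainEnd (segEnd c.1 l) t

def chainSum : List (List (ℕ × ℕ) × MR) → MR
  | [] => ⟨0, 0⟩
  | c :: t => c.2.add (chainSum t)

theorem Chain.enc {f : ℝ → ℝ} {F : Jet → Jet} (hF : JMap f F) :
    ∀ (cs : List (List (ℕ × ℕ) × MR)) (l : ℕ), (∀ c ∈ cs, ∀ p ∈ c.1, 0 < p.2) → Chain F l cs →
      IntervalIntegrable f volume (gp l) (gp (chainEnd l cs)) ∧
      Enc (∫ x in (gp l)..(gp (chainEnd l cs)), f x) (chainSum cs)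
  | [], l, _, _ => ⟨IntervalIntegrable.refl, by
      rw [chainEnd, intervalIntegral.integral_same]; exact Enc.zero 0⟩
  | c :: t, l, hL, h => by
    obtain ⟨h1, h2⟩ := h
    obtain ⟨a1, a2⟩ := hF.run l c.1 (hL c (by simp)) (inB_fst h1)
    obtain ⟨b1, b2⟩ := Chain.enc hF t _ (fun q hq => hL q (by simp [hq])) h2
    refine ⟨a1.trans b1, ?_⟩
    have := (inB_enc h1 a2).add b2
    rw [intervalIntegral.integral_add_adjacent_intervals a1 b1] at this
    exact this

def pcA : MR := ⟨Int.ofNat 743819616190, 549755815⟩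
def pcB : MR := ⟨Int.ofNat 745194005725, 824633722⟩
def pcC : MR := ⟨Int.ofNat 747393028980, 1374389536⟩
def pcD : MR := ⟨Int.ofNat 749866930143, 1099511629⟩
def pcE : MR := ⟨Int.ofNat 752615709212, 1649267443⟩

/-- A small box which contains the interval from `201 / 64` to `π`. -/
def endBox : Jet := Jet.var 3453690576896 536870912

def segF0 : List (Nat × Nat) := [(24, 7516192768)]
theorem runF0 :
    inB (segs (jF pcA) segF0 206158430208 acc0) ⟨154167803904, 2026110976⟩ = true ∧
    inB (segs (jF pcB) segF0 206158430208 acc0) ⟨153322913792, 2308046848⟩ = true ∧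
    inB (segs (jF pcC) segF0 206158430208 acc0) ⟨151983882240, 2869428224⟩ = true ∧
    inB (segs (jF pcD) segF0 206158430208 acc0) ⟨150495952896, 2546925568⟩ = true ∧
    inB (segs (jF pcE) segF0 206158430208 acc0) ⟨148865417216, 3084845056⟩ = true := by
  decide +kernel

def segF1 : List (Nat × Nat) := [(7, 7516192768), (12, 3758096384), (5, 1879048192)]
theorem runF1 :
    inB (segs (jF pcA) segF1 566935683072 acc0) ⟨1052271378432, 4471586816⟩ = true ∧
    inB (segs (jF pcB) segF1 566935683072 acc0) ⟨1046999990272, 6302728192⟩ = true ∧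
    inB (segs (jF pcC) segF1 566935683072 acc0) ⟨1038636941312, 9931980800⟩ = true ∧
    inB (segs (jF pcD) segF1 566935683072 acc0) ⟨1029332074496, 7988838400⟩ = true ∧
    inB (segs (jF pcE) segF1 566935683072 acc0) ⟨1019120254976, 11497701376⟩ = true := by
  decide +kernel

def segF2 : List (Nat × Nat) := [(17, 1879048192), (7, 939524096)]
theorem runF2 :
    inB (segs (jF pcA) segF2 781147176960 acc0) ⟨1519837184000, 4733140992⟩ = true ∧
    inB (segs (jF pcB) segF2 781147176960 acc0) ⟨1513927081984, 7032340480⟩ = true ∧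
    inB (segs (jF pcC) segF2 781147176960 acc0) ⟨1504527253504, 11598561280⟩ = true ∧
    inB (segs (jF pcD) segF2 781147176960 acc0) ⟨1494034677760, 9199681536⟩ = true ∧
    inB (segs (jF pcE) segF2 781147176960 acc0) ⟨1482477404160, 13650427904⟩ = true := by
  decide +kernel

def segF3 : List (Nat × Nat) := [(24, 939524096)]
theorem runF3 :
    inB (segs (jF pcA) segF3 858188152832 acc0) ⟨1574503907328, 3931045888⟩ = true ∧
    inB (segs (jF pcB) segF3 858188152832 acc0) ⟨1570580529152, 5875367936⟩ = true ∧
    inB (segs (jF pcC) segF3 858188152832 acc0) ⟨1564317843456, 9748283392⟩ = true ∧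
    inB (segs (jF pcD) segF3 858188152832 acc0) ⟨1557294088192, 7748583424⟩ = true ∧
    inB (segs (jF pcE) segF3 858188152832 acc0) ⟨1549517127680, 11559043072⟩ = true := by
  decide +kernel

def segF4 : List (Nat × Nat) := [(19, 939524096), (5, 1879048192)]
theorem runF4 :
    inB (segs (jF pcA) segF4 903285309440 acc0) ⟨2341251121152, 4222484480⟩ = true ∧
    inB (segs (jF pcB) segF4 903285309440 acc0) ⟨2339595485184, 6284705792⟩ = true ∧
    inB (segs (jF pcC) segF4 903285309440 acc0) ⟨2336928104448, 10405281792⟩ = true ∧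
    inB (segs (jF pcD) segF4 903285309440 acc0) ⟨2333900668928, 8319598592⟩ = true ∧
    inB (segs (jF pcE) segF4 903285309440 acc0) ⟨2330504200192, 12416188416⟩ = true := by
  decide +kernel

def segF5 : List (Nat × Nat) := [(14, 1879048192), (7, 3758096384), (3, 1879048192)]
theorem runF5 :
    inB (segs (jF pcA) segF5 957777707008 acc0) ⟨1304761532416, 4643225600⟩ = true ∧
    inB (segs (jF pcB) segF5 957777707008 acc0) ⟨1306001014784, 5648154624⟩ = true ∧
    inB (segs (jF pcC) segF5 957777707008 acc0) ⟨1307974565888, 7656308736⟩ = true ∧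
    inB (segs (jF pcD) segF5 957777707008 acc0) ⟨1310180442112, 6674186240⟩ = true ∧
    inB (segs (jF pcE) segF5 957777707008 acc0) ⟨1312613662720, 8687845376⟩ = true := by
  decide +kernel

def segF6 : List (Nat × Nat) := [(24, 1879048192)]
theorem runF6 :
    inB (segs (jF pcA) segF6 1074278694912 acc0) ⟨-1714586583040, 2338717696⟩ = true ∧
    inB (segs (jF pcB) segF6 1074278694912 acc0) ⟨-1716052492288, 3316973568⟩ = true ∧
    inB (segs (jF pcC) segF6 1074278694912 acc0) ⟨-1718384459776, 5274730496⟩ = true ∧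
    inB (segs (jF pcD) segF6 1074278694912 acc0) ⟨-1720988139520, 4299358208⟩ = true ∧
    inB (segs (jF pcE) segF6 1074278694912 acc0) ⟨-1723856584704, 6259081216⟩ = true := by
  decide +kernel

def segF7 : List (Nat × Nat) := [(9, 1879048192), (15, 3758096384)]
theorem runF7 :
    inB (segs (jF pcA) segF7 1164473008128 acc0) ⟨-2125995573248, 4888199168⟩ = true ∧
    inB (segs (jF pcB) segF7 1164473008128 acc0) ⟨-2124894437376, 6696730624⟩ = true ∧
    inB (segs (jF pcC) segF7 1164473008128 acc0) ⟨-2123112906752, 10311827456⟩ = true ∧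
    inB (segs (jF pcD) segF7 1164473008128 acc0) ⟨-2121079848960, 8490385408⟩ = true ∧
    inB (segs (jF pcE) segF7 1164473008128 acc0) ⟨-2118785630208, 12090474496⟩ = true := by
  decide +kernel

def segF8 : List (Nat × Nat) := [(23, 3758096384), (1, 7516192768)]
theorem runF8 :
    inB (segs (jF pcA) segF8 1311038767104 acc0) ⟨-1486497710080, 3625058304⟩ = true ∧
    inB (segs (jF pcB) segF8 1311038767104 acc0) ⟨-1484502138880, 5153619968⟩ = true ∧
    inB (segs (jF pcC) segF8 1311038767104 acc0) ⟨-1481302016000, 8206024704⟩ = true ∧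
    inB (segs (jF pcD) segF8 1311038767104 acc0) ⟨-1477691506688, 6652100608⟩ = true ∧
    inB (segs (jF pcE) segF8 1311038767104 acc0) ⟨-1473667465216, 9678946304⟩ = true := by
  decide +kernel

def segF9 : List (Nat × Nat) := [(24, 7516192768)]
theorem runF9 :
    inB (segs (jF pcA) segF9 1498943586304 acc0) ⟨-1533967532032, 4199677952⟩ = true ∧
    inB (segs (jF pcB) segF9 1498943586304 acc0) ⟨-1532457058304, 5695078400⟩ = true ∧
    inB (segs (jF pcC) segF9 1498943586304 acc0) ⟨-1530029735936, 8683847680⟩ = true ∧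
    inB (segs (jF pcD) segF9 1498943586304 acc0) ⟨-1527283908608, 7166427136⟩ = true ∧
    inB (segs (jF pcE) segF9 1498943586304 acc0) ⟨-1524214398976, 10136780800⟩ = true := by
  decide +kernel

def segF10 : List (Nat × Nat) := [(4, 7516192768), (20, 15032385536)]
theorem runF10 :
    inB (segs (jF pcA) segF10 1859720839168 acc0) ⟨-895302172672, 3899260928⟩ = true ∧
    inB (segs (jF pcB) segF10 1859720839168 acc0) ⟨-895989776384, 4439932928⟩ = true ∧
    inB (segs (jF pcC) segF10 1859720839168 acc0) ⟨-897083179008, 5520818176⟩ = true ∧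
    inB (segs (jF pcD) segF10 1859720839168 acc0) ⟨-898303328256, 4987944960⟩ = true ∧
    inB (segs (jF pcE) segF10 1859720839168 acc0) ⟨-899646881792, 6070599680⟩ = true := by
  decide +kernel

def segF11 : List (Nat × Nat) := [(3, 15032385536), (14, 30064771072)]
theorem runF11 :
    inB (segs (jF pcA) segF11 2521145802752 acc0) ⟨60806266880, 4402315264⟩ = true ∧
    inB (segs (jF pcB) segF11 2521145802752 acc0) ⟨60917678080, 4438818816⟩ = true ∧
    inB (segs (jF pcC) segF11 2521145802752 acc0) ⟨61095870464, 4508614656⟩ = true ∧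
    inB (segs (jF pcD) segF11 2521145802752 acc0) ⟨61296345088, 4495310848⟩ = true ∧
    inB (segs (jF pcE) segF11 2521145802752 acc0) ⟨61519101952, 4568383488⟩ = true := by
  decide +kernel

def chainFA : List (List (ℕ × ℕ) × MR) :=
  [(segF0, ⟨154167803904, 2026110976⟩),
   (segF1, ⟨1052271378432, 4471586816⟩),
   (segF2, ⟨1519837184000, 4733140992⟩),
   (segF3, ⟨1574503907328, 3931045888⟩),
   (segF4, ⟨2341251121152, 4222484480⟩),
   (segF5, ⟨1304761532416, 4643225600⟩),
   (segF6, ⟨-1714586583040, 2338717696⟩),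
   (segF7, ⟨-2125995573248, 4888199168⟩),
   (segF8, ⟨-1486497710080, 3625058304⟩),
   (segF9, ⟨-1533967532032, 4199677952⟩),
   (segF10, ⟨-895302172672, 3899260928⟩),
   (segF11, ⟨60806266880, 4402315264⟩)]
theorem chainFA_ok : Chain (jF pcA) 206158430208 chainFA :=
  ⟨runF0.1, runF1.1, runF2.1, runF3.1, runF4.1, runF5.1, runF6.1, runF7.1, runF8.1, runF9.1, runF10.1, runF11.1, trivial⟩

def chainFB : List (List (ℕ × ℕ) × MR) :=
  [(segF0, ⟨153322913792, 2308046848⟩),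
   (segF1, ⟨1046999990272, 6302728192⟩),
   (segF2, ⟨1513927081984, 7032340480⟩),
   (segF3, ⟨1570580529152, 5875367936⟩),
   (segF4, ⟨2339595485184, 6284705792⟩),
   (segF5, ⟨1306001014784, 5648154624⟩),
   (segF6, ⟨-1716052492288, 3316973568⟩),
   (segF7, ⟨-2124894437376, 6696730624⟩),
   (segF8, ⟨-1484502138880, 5153619968⟩),
   (segF9, ⟨-1532457058304, 5695078400⟩),
   (segF10, ⟨-895989776384, 4439932928⟩),
   (segF11, ⟨60917678080, 4438818816⟩)]
theorem chainFB_ok : Chain (jF pcB) 206158430208 chainFB :=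
  ⟨runF0.2.1, runF1.2.1, runF2.2.1, runF3.2.1, runF4.2.1, runF5.2.1, runF6.2.1, runF7.2.1, runF8.2.1, runF9.2.1, runF10.2.1, runF11.2.1, trivial⟩

def chainFC : List (List (ℕ × ℕ) × MR) :=
  [(segF0, ⟨151983882240, 2869428224⟩),
   (segF1, ⟨1038636941312, 9931980800⟩),
   (segF2, ⟨1504527253504, 11598561280⟩),
   (segF3, ⟨1564317843456, 9748283392⟩),
   (segF4, ⟨2336928104448, 10405281792⟩),
   (segF5, ⟨1307974565888, 7656308736⟩),
   (segF6, ⟨-1718384459776, 5274730496⟩),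
   (segF7, ⟨-2123112906752, 10311827456⟩),
   (segF8, ⟨-1481302016000, 8206024704⟩),
   (segF9, ⟨-1530029735936, 8683847680⟩),
   (segF10, ⟨-897083179008, 5520818176⟩),
   (segF11, ⟨61095870464, 4508614656⟩)]
theorem chainFC_ok : Chain (jF pcC) 206158430208 chainFC :=
  ⟨runF0.2.2.1, runF1.2.2.1, runF2.2.2.1, runF3.2.2.1, runF4.2.2.1, runF5.2.2.1, runF6.2.2.1, runF7.2.2.1, runF8.2.2.1, runF9.2.2.1, runF10.2.2.1, runF11.2.2.1, trivial⟩

def chainFD : List (List (ℕ × ℕ) × MR) :=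
  [(segF0, ⟨150495952896, 2546925568⟩),
   (segF1, ⟨1029332074496, 7988838400⟩),
   (segF2, ⟨1494034677760, 9199681536⟩),
   (segF3, ⟨1557294088192, 7748583424⟩),
   (segF4, ⟨2333900668928, 8319598592⟩),
   (segF5, ⟨1310180442112, 6674186240⟩),
   (segF6, ⟨-1720988139520, 4299358208⟩),
   (segF7, ⟨-2121079848960, 8490385408⟩),
   (segF8, ⟨-1477691506688, 6652100608⟩),
   (segF9, ⟨-1527283908608, 7166427136⟩),
   (segF10, ⟨-898303328256, 4987944960⟩),
   (segF11, ⟨61296345088, 4495310848⟩)]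
theorem chainFD_ok : Chain (jF pcD) 206158430208 chainFD :=
  ⟨runF0.2.2.2.1, runF1.2.2.2.1, runF2.2.2.2.1, runF3.2.2.2.1, runF4.2.2.2.1, runF5.2.2.2.1, runF6.2.2.2.1, runF7.2.2.2.1, runF8.2.2.2.1, runF9.2.2.2.1, runF10.2.2.2.1, runF11.2.2.2.1, trivial⟩

def chainFE : List (List (ℕ × ℕ) × MR) :=
  [(segF0, ⟨148865417216, 3084845056⟩),
   (segF1, ⟨1019120254976, 11497701376⟩),
   (segF2, ⟨1482477404160, 13650427904⟩),
   (segF3, ⟨1549517127680, 11559043072⟩),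
   (segF4, ⟨2330504200192, 12416188416⟩),
   (segF5, ⟨1312613662720, 8687845376⟩),
   (segF6, ⟨-1723856584704, 6259081216⟩),
   (segF7, ⟨-2118785630208, 12090474496⟩),
   (segF8, ⟨-1473667465216, 9678946304⟩),
   (segF9, ⟨-1524214398976, 10136780800⟩),
   (segF10, ⟨-899646881792, 6070599680⟩),
   (segF11, ⟨61519101952, 4568383488⟩)]
theorem chainFE_ok : Chain (jF pcE) 206158430208 chainFE :=
  ⟨runF0.2.2.2.2, runF1.2.2.2.2, runF2.2.2.2.2, runF3.2.2.2.2, runF4.2.2.2.2, runF5.2.2.2.2, runF6.2.2.2.2, runF7.2.2.2.2, runF8.2.2.2.2, runF9.2.2.2.2, runF10.2.2.2.2, runF11.2.2.2.2, trivial⟩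

def segV0 : List (Nat × Nat) := [(17, 25769803776)]
theorem runV0 :
    inB (segs (jV pcA) segV0 0 acc0) ⟨1023344640, 38469632⟩ = true ∧
    inB (segs (jV pcB) segV0 0 acc0) ⟨1017643008, 45547520⟩ = true ∧
    inB (segs (jV pcC) segV0 0 acc0) ⟨1008599040, 59572224⟩ = true ∧
    inB (segs (jV pcD) segV0 0 acc0) ⟨998506496, 51707904⟩ = true ∧
    inB (segs (jV pcE) segV0 0 acc0) ⟨987496448, 65208320⟩ = true := by
  decide +kernel

def segV1 : List (Nat × Nat) := [(17, 25769803776)]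
theorem runV1 :
    inB (segs (jV pcA) segV1 876173328384 acc0) ⟨-86599008256, 1756430336⟩ = true ∧
    inB (segs (jV pcB) segV1 876173328384 acc0) ⟨-86248194048, 2185625600⟩ = true ∧
    inB (segs (jV pcC) segV1 876173328384 acc0) ⟨-85690417152, 3040477184⟩ = true ∧
    inB (segs (jV pcD) segV1 876173328384 acc0) ⟨-85068218368, 2577727488⟩ = true ∧
    inB (segs (jV pcE) segV1 876173328384 acc0) ⟨-84383367168, 3407872000⟩ = true := by
  decide +kernel

def segV2 : List (Nat × Nat) := [(17, 25769803776)]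
theorem runV2 :
    inB (segs (jV pcA) segV2 1752346656768 acc0) ⟨-121719816192, 3147956224⟩ = true ∧
    inB (segs (jV pcB) segV2 1752346656768 acc0) ⟨-121580683264, 3922984960⟩ = true ∧
    inB (segs (jV pcC) segV2 1752346656768 acc0) ⟨-121356746752, 5470683136⟩ = true ∧
    inB (segs (jV pcD) segV2 1752346656768 acc0) ⟨-121102794752, 4661313536⟩ = true ∧
    inB (segs (jV pcE) segV2 1752346656768 acc0) ⟨-120818237440, 6184697856⟩ = true := by
  decide +kernel

def segV3 : List (Nat × Nat) := [(16, 25769803776)]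
theorem runV3 :
    inB (segs (jV pcA) segV3 2628519985152 acc0) ⟨-5781782528, 676003840⟩ = true ∧
    inB (segs (jV pcB) segV3 2628519985152 acc0) ⟨-5743181824, 915341312⟩ = true ∧
    inB (segs (jV pcC) segV3 2628519985152 acc0) ⟨-5681315840, 1393491968⟩ = true ∧
    inB (segs (jV pcD) segV3 2628519985152 acc0) ⟨-5611651072, 1150353408⟩ = true ∧
    inB (segs (jV pcE) segV3 2628519985152 acc0) ⟨-5534121984, 1625030656⟩ = true := by
  decide +kernel

def chainVA : List (List (ℕ × ℕ) × MR) :=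
  [(segV0, ⟨1023344640, 38469632⟩),
   (segV1, ⟨-86599008256, 1756430336⟩),
   (segV2, ⟨-121719816192, 3147956224⟩),
   (segV3, ⟨-5781782528, 676003840⟩)]
theorem chainVA_ok : Chain (jV pcA) 0 chainVA :=
  ⟨runV0.1, runV1.1, runV2.1, runV3.1, trivial⟩

def chainVB : List (List (ℕ × ℕ) × MR) :=
  [(segV0, ⟨1017643008, 45547520⟩),
   (segV1, ⟨-86248194048, 2185625600⟩),
   (segV2, ⟨-121580683264, 3922984960⟩),
   (segV3, ⟨-5743181824, 915341312⟩)]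
theorem chainVB_ok : Chain (jV pcB) 0 chainVB :=
  ⟨runV0.2.1, runV1.2.1, runV2.2.1, runV3.2.1, trivial⟩

def chainVC : List (List (ℕ × ℕ) × MR) :=
  [(segV0, ⟨1008599040, 59572224⟩),
   (segV1, ⟨-85690417152, 3040477184⟩),
   (segV2, ⟨-121356746752, 5470683136⟩),
   (segV3, ⟨-5681315840, 1393491968⟩)]
theorem chainVC_ok : Chain (jV pcC) 0 chainVC :=
  ⟨runV0.2.2.1, runV1.2.2.1, runV2.2.2.1, runV3.2.2.1, trivial⟩

def chainVD : List (List (ℕ × ℕ) × MR) :=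
  [(segV0, ⟨998506496, 51707904⟩),
   (segV1, ⟨-85068218368, 2577727488⟩),
   (segV2, ⟨-121102794752, 4661313536⟩),
   (segV3, ⟨-5611651072, 1150353408⟩)]
theorem chainVD_ok : Chain (jV pcD) 0 chainVD :=
  ⟨runV0.2.2.2.1, runV1.2.2.2.1, runV2.2.2.2.1, runV3.2.2.2.1, trivial⟩

def chainVE : List (List (ℕ × ℕ) × MR) :=
  [(segV0, ⟨987496448, 65208320⟩),
   (segV1, ⟨-84383367168, 3407872000⟩),
   (segV2, ⟨-120818237440, 6184697856⟩),
   (segV3, ⟨-5534121984, 1625030656⟩)]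
theorem chainVE_ok : Chain (jV pcE) 0 chainVE :=
  ⟨runV0.2.2.2.2, runV1.2.2.2.2, runV2.2.2.2.2, runV3.2.2.2.2, trivial⟩

def ipos : Int → Bool
  | Int.ofNat n => Nat.blt 0 n
  | Int.negSucc _ => false

theorem ipos_iff {a : ℤ} (h : ipos a = true) : 0 < a := by
  cases a with
  | ofNat n => simpa [ipos, Nat.blt_eq] using h
  | negSucc n => simp [ipos] at h

def chkTail (F : Jet → Jet) : Bool := and (F endBox).ok (Nat.ble (F endBox).a.mag 10995116277)

theorem pi_sub_lt : π - 201 / 64 < 1 / 1000 := by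
  have := Real.pi_lt_d4
  linarith

theorem pi_sub_pos : 0 < π - 201 / 64 := by
  have := Real.pi_gt_d4
  linarith

theorem mem_endBox {x : ℝ} (hx : x ∈ Set.Icc (201 / 64) π) :
    Enc x ⟨(3453690576896 : ℕ), 536870912⟩ := by
  have h := pi_sub_lt
  have h2 := Real.pi_lt_d4
  rw [enc_box, gp, gp]
  push_cast
  constructor <;> linarith [hx.1, hx.2]

theorem JMap.tail {f : ℝ → ℝ} {F : Jet → Jet} (hF : JMap f F) (h : chkTail F = true) :
    ContinuousOn f (Set.Icc (201 / 64) π) ∧ ∀ x ∈ Set.Icc (201 / 64) π, |f x| ≤ 1 / 100 := by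
  simp only [chkTail, Bool.and_eq_true, Nat.ble_eq] at h
  obtain ⟨f1, f2, h1⟩ := hF _ _ (JE.var 3453690576896 536870912) h.1
  refine ⟨fun x hx => (h1 x (mem_endBox hx)).1.continuousAt.continuousWithinAt, fun x hx => ?_⟩
  have h3 := (h1 x (mem_endBox hx)).2.2.1.abs_le_mag
  have h4 : ((F endBox).a.mag : ℝ) ≤ 10995116277 := by exact_mod_cast h.2
  have h5 : |f x| * 1099511627776 ≤ 10995116277 := h3.trans h4
  linarith

theorem JMap.tail_int {f : ℝ → ℝ} {F : Jet → Jet} (hF : JMap f F) (h : chkTail F = true) :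
    IntervalIntegrable f volume (201 / 64) π ∧ |∫ x in (201 / 64)..π, f x| ≤ 1 / 100000 := by
  obtain ⟨h1, h2⟩ := hF.tail h
  have hp := pi_sub_pos
  have hq := pi_sub_lt
  refine ⟨ContinuousOn.intervalIntegrable (by rwa [Set.uIcc_of_le (by linarith)]), ?_⟩
  have := intervalIntegral.norm_integral_le_of_norm_le_const (a := 201 / 64) (b := π) (f := f)
    (C := 1 / 100) (fun x hx => by
      rw [Set.uIoc_of_le (by linarith)] at hx
      exact h2 x ⟨hx.1.le, hx.2⟩)
  rw [Real.norm_eq_abs, abs_of_pos hp] at this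
  linarith

def chkSum (H : MR) (cF cV : List (List (ℕ × ℕ) × MR)) : Bool :=
  and (and (and H.okSin H.sin.pos) (Nat.ble (H.cos.mul H.sin.inv).mag 1374389534720))
    (and (and (chkTail (jF H)) (chkTail (jV H)))
      (and (ipos (Int.sub (Int.sub (chainSum cF).m (Int.ofNat (chainSum cF).r)) 21990232))
        (ipos (Int.neg (Int.add (Int.add (Int.add (chainSum cF).m (Int.ofNat (chainSum cF).r))
          (Int.mul 2 (Int.add (chainSum cV).m (Int.ofNat (chainSum cV).r)))) 88060930222)))))

structure Numeric (h : ℝ) : Prop where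
  intF : IntervalIntegrable (rF h) volume (3 / 16) π
  lower : 0 < ∫ x in (3 / 16)..π, rF h x
  upper : (∫ x in (3 / 16)..π, rF h x) + 2 * (∫ x in (0)..π, rV h x) + 8 / 100 < 0
  cot : Real.cos h * (Real.sin h)⁻¹ ≤ 5 / 4

theorem numeric_of {h : ℝ} {H : MR} {cF cV : List (List (ℕ × ℕ) × MR)} (hH : Enc h H)
    (hF : Chain (jF H) 206158430208 cF) (hV : Chain (jV H) 0 cV)
    (pF : ∀ c ∈ cF, ∀ p ∈ c.1, 0 < p.2) (pV : ∀ c ∈ cV, ∀ p ∈ c.1, 0 < p.2)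
    (eF : chainEnd 206158430208 cF = 3453153705984) (eV : chainEnd 0 cV = 3453153705984)
    (hc : chkSum H cF cV = true) : Numeric h := by
  simp only [chkSum, Bool.and_eq_true, Nat.ble_eq] at hc
  obtain ⟨⟨⟨c1, c2⟩, c3⟩, ⟨c4, c5⟩, c6, c7⟩ := hc
  have jf := jmap_F hH
  have jv := jmap_V hH c1 c2
  obtain ⟨f1, f2⟩ := Chain.enc jf cF _ pF hF
  obtain ⟨v1, v2⟩ := Chain.enc jv cV _ pV hV
  rw [eF] at f1 f2
  rw [eV] at v1 v2
  have g0 : gp 0 = 0 := by simp [gp]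
  have g1 : gp 206158430208 = 3 / 16 := by norm_num [gp]
  have g2 : gp 3453153705984 = 201 / 64 := by norm_num [gp]
  rw [g1, g2] at f1 f2
  rw [g0, g2] at v1 v2
  obtain ⟨tf1, tf2⟩ := jf.tail_int c4
  obtain ⟨tv1, tv2⟩ := jv.tail_int c5
  have c6' : (0 : ℝ) < (((chainSum cF).m - ((chainSum cF).r : ℤ) - 21990232 : ℤ) : ℝ) := by
    exact_mod_cast ipos_iff c6
  have c7' : (0 : ℝ) < ((-((chainSum cF).m + ((chainSum cF).r : ℤ) +
      2 * ((chainSum cV).m + ((chainSum cV).r : ℤ)) + 88060930222) : ℤ) : ℝ) := by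
    exact_mod_cast ipos_iff c7
  push_cast at c6' c7'
  unfold Enc at f2 v2
  rw [abs_le] at f2 v2 tf2 tv2
  refine ⟨f1.trans tf1, ?_, ?_, ?_⟩
  · rw [← intervalIntegral.integral_add_adjacent_intervals f1 tf1]
    linarith [f2.1, f2.2, tf2.1, tf2.2]
  · rw [← intervalIntegral.integral_add_adjacent_intervals f1 tf1,
      ← intervalIntegral.integral_add_adjacent_intervals v1 tv1]
    linarith [f2.1, f2.2, tf2.1, tf2.2, v2.1, v2.2, tv2.1, tv2.2]
  · have h3 := ((hH.cos c1).mul ((hH.sin c1).inv c2)).abs_le_mag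
    have h4 : ((H.cos.mul H.sin.inv).mag : ℝ) ≤ 1374389534720 := by exact_mod_cast c3
    have h5 := le_abs_self (Real.cos h * (Real.sin h)⁻¹)
    linarith

set_option maxRecDepth 100000 in
theorem sum_A : chkSum pcA chainFA chainVA = true := by decide +kernel
set_option maxRecDepth 100000 in
theorem sum_B : chkSum pcB chainFB chainVB = true := by decide +kernel
set_option maxRecDepth 100000 in
theorem sum_C : chkSum pcC chainFC chainVC = true := by decide +kernel
set_option maxRecDepth 100000 in
theorem sum_D : chkSum pcD chainFD chainVD = true := by decide +kernel
set_option maxRecDepth 100000 in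
theorem sum_E : chkSum pcE chainFE chainVE = true := by decide +kernel

theorem enc_between {h : ℝ} {m : ℤ} {r : ℕ} (h1 : (m : ℝ) - r ≤ h * 1099511627776)
    (h2 : h * 1099511627776 ≤ m + r) : Enc h ⟨m, r⟩ := by
  unfold Enc
  rw [abs_le]
  constructor <;> linarith

theorem numeric {h : ℝ} (h1 : 0.676 < h) (h2 : h < 0.686) : Numeric h := by
  norm_num at h1 h2
  by_cases a1 : h ≤ 677 / 1000
  · refine numeric_of (H := pcA) (enc_between ?_ ?_) chainFA_ok chainVA_ok (by decide) (by decide)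
      (by decide +kernel) (by decide +kernel) sum_A <;> push_cast <;> linarith
  by_cases a2 : h ≤ 6785 / 10000
  · refine numeric_of (H := pcB) (enc_between ?_ ?_) chainFB_ok chainVB_ok (by decide) (by decide)
      (by decide +kernel) (by decide +kernel) sum_B <;> push_cast <;> linarith
  by_cases a3 : h ≤ 681 / 1000
  · refine numeric_of (H := pcC) (enc_between ?_ ?_) chainFC_ok chainVC_ok (by decide) (by decide)
      (by decide +kernel) (by decide +kernel) sum_C <;> push_cast <;> linarith
  by_cases a4 : h ≤ 683 / 1000
  · refine numeric_of (H := pcD) (enc_between ?_ ?_) chainFD_ok chainVD_ok (by decide) (by decide)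
      (by decide +kernel) (by decide +kernel) sum_D <;> push_cast <;> linarith
  · refine numeric_of (H := pcE) (enc_between ?_ ?_) chainFE_ok chainVE_ok (by decide) (by decide)
      (by decide +kernel) (by decide +kernel) sum_E <;> push_cast <;> linarith

/-! ### The weight integral -/

def mPanel (m d : Nat) : Nat :=
  Nat.add (Nat.shiftRight (Nat.mul (Nat.add (jM (Jet.var m 0)).a.mag
    (Nat.add (Nat.shiftRight (Nat.mul (jM (Jet.var m d)).b.mag d) 40) 1)) (Nat.mul 2 d)) 40) 1

def mLoop : Nat → Nat → Nat → Bool × Nat → Bool × Nat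
  | 0, _, _, acc => acc
  | k+1, l, d, acc =>
    mLoop k (Nat.add l (Nat.mul 2 d)) d
      (and acc.1 (and (jM (Jet.var (Nat.add l d) 0)).ok (jM (Jet.var (Nat.add l d) d)).ok),
        Nat.add acc.2 (mPanel (Nat.add l d) d))

theorem mLoop_fst : ∀ k l d acc, (mLoop k l d acc).1 = true → acc.1 = true
  | 0, _, _, _, h => h
  | k+1, l, d, acc, h => by
    have := mLoop_fst k _ _ _ h
    simp only [Bool.and_eq_true] at this
    exact this.1

theorem continuous_rM : Continuous rM := by
  unfold rM rP rZ rW rG rE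
  fun_prop

theorem mPanel_bound {m d : ℕ} (hd : 0 < d) (h0 : (jM (Jet.var m 0)).ok = true)
    (h1 : (jM (Jet.var m d)).ok = true) :
    (∫ x in (gp m - gp d)..(gp m + gp d), |rM x|) * 1099511627776 ≤ mPanel m d := by
  obtain ⟨f1, f2, hb⟩ := jmap_M _ _ (JE.var m d) h1
  obtain ⟨g1, g2, hc⟩ := jmap_M _ _ (JE.var m 0) h0
  have hd0 : 0 < gp d := by unfold gp; positivity
  have hmE : Enc (gp m) ⟨m, 0⟩ := by
    have := Enc.exact (Int.ofNat m)
    simpa [gp] using this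
  have hv := (hc (gp m) hmE).2.2.1.abs_le_mag
  set A := (jM (Jet.var m 0)).a.mag with hA
  set B := (jM (Jet.var m d)).b.mag with hB
  have hset : ∀ x ∈ Set.Icc (gp m - gp d) (gp m + gp d), x ∈ {x | Enc x ⟨m, d⟩} :=
    fun x hx => enc_box.mpr hx
  have hm : gp m ∈ Set.Icc (gp m - gp d) (gp m + gp d) := ⟨by linarith, by linarith⟩
  have hbd : ∀ x ∈ Set.Icc (gp m - gp d) (gp m + gp d), |rM x| ≤
      A / 1099511627776 + B / 1099511627776 * gp d := by
    intro x hx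
    have h3 := (convex_Icc (gp m - gp d) (gp m + gp d)).norm_image_sub_le_of_norm_hasDerivWithin_le
      (f := rM) (f' := f1) (C := B / 1099511627776)
      (fun y hy => (hb y (hset y hy)).1.hasDerivWithinAt)
      (fun y hy => by
        have := (hb y (hset y hy)).2.2.2.1.abs_le_mag
        rw [Real.norm_eq_abs, le_div_iff₀ (by norm_num)]
        exact this) hm hx
    rw [Real.norm_eq_abs, Real.norm_eq_abs] at h3
    have h4 : |x - gp m| ≤ gp d := by rw [abs_le]; constructor <;> linarith [hx.1, hx.2]
    have h5 : (B : ℝ) / 1099511627776 * |x - gp m| ≤ B / 1099511627776 * gp d := by gcongr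
    have h6 : |rM (gp m)| ≤ A / 1099511627776 := by
      rw [le_div_iff₀ (by norm_num)]; exact hv
    have h7 : |rM x| ≤ |rM (gp m)| + |rM x - rM (gp m)| := by
      calc |rM x| = |rM (gp m) + (rM x - rM (gp m))| := by ring_nf
        _ ≤ _ := abs_add_le _ _
    linarith
  have hinteg : ∫ x in (gp m - gp d)..(gp m + gp d), |rM x| ≤
      ∫ _ in (gp m - gp d)..(gp m + gp d), (A / 1099511627776 + B / 1099511627776 * gp d : ℝ) :=
    intervalIntegral.integral_mono_on (by linarith)
      (continuous_rM.abs.intervalIntegrable _ _) (by simp) hbd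
  rw [intervalIntegral.integral_const, smul_eq_mul] at hinteg
  have s1 := Enc.shift_nat (B * d)
  have s2 := Enc.shift_nat ((A + (Nat.shiftRight (B * d) 40 + 1)) * (2 * d))
  unfold mPanel
  simp only [Nat.add_eq, Nat.mul_eq]
  rw [← hA, ← hB]
  push_cast at s1 s2 ⊢
  refine le_trans ?_ s2
  refine (mul_le_mul_of_nonneg_right hinteg (by norm_num)).trans ?_
  have e : (gp m + gp d - (gp m - gp d)) * ((A : ℝ) / 1099511627776 + B / 1099511627776 * gp d)
      * 1099511627776 = (A + B * d / 1099511627776) * (2 * d) / 1099511627776 := by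
    unfold gp; ring
  rw [e]
  gcongr

theorem mLoop_bound (d : ℕ) (hd : 0 < d) : ∀ (k l : ℕ) (acc : Bool × ℕ),
    (∫ x in (0)..(gp l), |rM x|) * 1099511627776 ≤ acc.2 → (mLoop k l d acc).1 = true →
    (∫ x in (0)..(gp (l + k * (2 * d))), |rM x|) * 1099511627776 ≤ (mLoop k l d acc).2
  | 0, l, acc, h, _ => by simpa [mLoop] using h
  | k+1, l, acc, h, hok => by
    have h3 := mLoop_fst k _ _ _ hok
    simp only [Bool.and_eq_true] at h3
    have p := mPanel_bound hd h3.2.1 h3.2.2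
    have e1 : gp (Nat.add l d) - gp d = gp l := by
      unfold gp; push_cast [Nat.add_eq]; ring
    have e2 : gp (Nat.add l d) + gp d = gp (l + 2 * d) := by
      unfold gp; push_cast [Nat.add_eq]; ring
    rw [e1, e2] at p
    have h4 := mLoop_bound d hd k (l + 2 * d) _ (by
      rw [← intervalIntegral.integral_add_adjacent_intervals
        (continuous_rM.abs.intervalIntegrable _ (gp l))
        (continuous_rM.abs.intervalIntegrable _ _), add_mul]
      push_cast [Nat.add_eq]
      exact add_le_add h p) hok
    rw [show l + (k + 1) * (2 * d) = l + 2 * d + k * (2 * d) by ring]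
    exact h4

def chkM : Bool :=
  and (chkTail jM) (and (mLoop 67 0 25769803776 (true, 0)).1
    (Nat.ble (mLoop 67 0 25769803776 (true, 0)).2 1176000000000))

theorem chkM_ok : chkM = true := by decide +kernel

theorem weight_bound : ∫ x in (0)..π, |rM x| ≤ 107 / 100 := by
  have h := chkM_ok
  simp only [chkM, Bool.and_eq_true, Nat.ble_eq] at h
  obtain ⟨h1, h2, h3⟩ := h
  have h4 := mLoop_bound 25769803776 (by norm_num) 67 0 (true, 0) (by simp [gp]) h2
  have h5 : (((mLoop 67 0 25769803776 (true, 0)).2 : ℕ) : ℝ) ≤ 1176000000000 := by exact_mod_cast h3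
  have h6 := jmap_M.tail h1
  have hp := pi_sub_pos
  have hq := pi_sub_lt
  have h7 : ∫ x in (201 / 64)..π, |rM x| ≤ ∫ _ in (201 / 64)..π, (1 / 100 : ℝ) :=
    intervalIntegral.integral_mono_on (by linarith)
      (continuous_rM.abs.intervalIntegrable _ _) (by simp) h6.2
  rw [intervalIntegral.integral_const, smul_eq_mul] at h7
  have g2 : gp (0 + 67 * (2 * 25769803776)) = 201 / 64 := by norm_num [gp]
  rw [g2] at h4
  rw [← intervalIntegral.integral_add_adjacent_intervals
        (continuous_rM.abs.intervalIntegrable _ (201 / 64))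
        (continuous_rM.abs.intervalIntegrable _ _)]
  linarith

/-! ### Identification of the curve -/

theorem rE_eq (β : ℝ) : Real.exp (-(1 / 10000) * β ^ 2) = rE β := by
  unfold rE
  congr 1
  push_cast
  ring

theorem z1_eq : z₁ = rZ := by
  funext β
  unfold z₁ rZ
  rw [rE_eq]

theorem hasDerivAt_rE (β : ℝ) : HasDerivAt rE (-(β / 5000) * rE β) β := by
  have h1 : HasDerivAt (fun x : ℝ => -(x * x / (10000 : ℕ))) (-((1 * β + β * 1) / (10000 : ℕ))) β :=
    (((hasDerivAt_id β).mul (hasDerivAt_id β)).div_const _).neg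
  refine h1.exp.congr_deriv ?_
  unfold rE
  push_cast
  ring

theorem hasDerivAt_rZ (β : ℝ) : HasDerivAt rZ (rP β) β := by
  have := (hasDerivAt_id β).sub ((Real.hasDerivAt_sin β).mul (hasDerivAt_rE β))
  refine this.congr_deriv ?_
  unfold rP
  push_cast
  ring

theorem deriv_z1 (β : ℝ) : deriv z₁ β = rP β := by
  rw [z1_eq]; exact (hasDerivAt_rZ β).deriv

theorem continuous_rE : Continuous rE := by unfold rE; fun_prop
theorem continuous_rZ : Continuous rZ := by unfold rZ rE; fun_prop
theorem continuous_rP : Continuous rP := by unfold rP rE; fun_prop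
theorem continuous_rW : Continuous rW := by unfold rW rG; fun_prop

theorem z2_eq {h β : ℝ} (hβ : |β| ≤ π) : z₂ h β = h * rW β := by
  unfold z₂ rW rG
  rw [if_pos hβ, Real.sin_three_mul]
  have e1 : -(β + 2) ^ 2 = -(((2 : ℕ) * 1 + β) * ((2 : ℕ) * 1 + β)) := by push_cast; ring
  have e2 : -(β - 2) ^ 2 = -((-((2 : ℕ) * 1) + β) * (-((2 : ℕ) * 1) + β)) := by push_cast; ring
  rw [e1, e2]
  push_cast
  ring

theorem z2_zero {h β : ℝ} (hβ : π < |β|) : z₂ h β = 0 := by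
  unfold z₂
  rw [if_neg (not_le.mpr hβ)]

theorem rE_pos (β : ℝ) : 0 < rE β := Real.exp_pos _
theorem rE_le (β : ℝ) : rE β ≤ 1 := by
  unfold rE
  rw [Real.exp_le_one_iff]
  push_cast
  have := mul_self_nonneg β
  linarith
theorem rE_ge (β : ℝ) : 1 - β ^ 2 / 10000 ≤ rE β := by
  unfold rE
  have := Real.add_one_le_exp (-(β * β / (10000 : ℕ)))
  push_cast at *
  nlinarith

theorem rZ_nonneg {β : ℝ} (hβ : 0 ≤ β) : 0 ≤ rZ β := by
  unfold rZ
  have h1 := Real.sin_le hβ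
  have h2 := rE_pos β
  have h3 := rE_le β
  nlinarith [mul_le_mul_of_nonneg_right h1 h2.le, mul_le_mul_of_nonneg_left h3 hβ]

theorem rP_nonneg {β : ℝ} (hβ : 0 ≤ β) (hp : β ≤ π) : 0 ≤ rP β := by
  unfold rP
  have h2 := rE_pos β
  have h3 := rE_le β
  have h4 := Real.sin_nonneg_of_nonneg_of_le_pi hβ hp
  have h5 : 0 ≤ β * (Real.sin β * rE β) / (5000 : ℕ) := by positivity
  have h6 : Real.cos β * rE β ≤ 1 := by
    have := Real.cos_le_one β
    nlinarith [mul_le_mul_of_nonneg_right this h2.le]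
  linarith

theorem rS_eq (β : ℝ) : rS β = Real.sinh (rZ β) := by
  unfold rS
  rw [Real.sinh_eq]
  push_cast
  ring

/-- The integrand of `I₁`. -/
noncomputable def iF (h β : ℝ) : ℝ :=
  deriv z₁ β * Real.sinh (z₁ β) * Real.sin (z₂ h β) /
          (Real.cosh (z₁ β) - Real.cos (z₂ h β)) ^ 2 +
        deriv z₁ β * Real.sinh (z₁ β) * Real.sin (z₂ h β) /
          (Real.cosh (z₁ β) + Real.cos (z₂ h β)) ^ 2

theorem iF_eq {h β : ℝ} (hβ : |β| ≤ π) : iF h β = rF h β := by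
  unfold iF rF
  rw [deriv_z1, z2_eq hβ, z1_eq, ← rS_eq]
  set S := rS β with hS
  set c := Real.cos (h * rW β) with hc
  set s := Real.sin (h * rW β) with hs
  have hsc : s ^ 2 + c ^ 2 = 1 := Real.sin_sq_add_cos_sq _
  by_cases h0 : rZ β = 0
  · have : S = 0 := by rw [hS, rS_eq, h0, Real.sinh_zero]
    rw [this]; simp
  have hC : 1 < Real.cosh (rZ β) := Real.one_lt_cosh.mpr h0
  have hCS : Real.cosh (rZ β) ^ 2 = S ^ 2 + 1 := by rw [hS, rS_eq, Real.cosh_sq]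
  set C := Real.cosh (rZ β)
  have hc1 : c ≤ 1 := Real.cos_le_one _
  have hc2 : -1 ≤ c := Real.neg_one_le_cos _
  have p1 : C - c ≠ 0 := by linarith
  have p2 : C + c ≠ 0 := by linarith
  have e : S * S + s * s = (C - c) * (C + c) := by nlinarith
  have e2 : (2 : ℕ) * 1 + (S * S - s * s) = C ^ 2 + c ^ 2 := by push_cast; nlinarith
  rw [e, e2]
  field_simp
  push_cast
  ring

theorem iF_zero {h β : ℝ} (hβ : π < |β|) : iF h β = 0 := by
  unfold iF
  rw [z2_zero hβ]
  simp

/-! ### The start interval -/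

set_option maxHeartbeats 1000000 in
theorem rF_start {h β : ℝ} (h1 : 0.676 < h) (h2 : h < 0.686) (b0 : 0 < β) (b1 : β ≤ 3 / 16) :
    0 ≤ rF h β ∧ rF h β ≤ 4 * β ^ 2 := by
  norm_num at h1 h2
  have hb2 : β ^ 2 ≤ 9 / 256 := by nlinarith
  have hb2' : 0 < β ^ 2 := by positivity
  have hb3' : 0 < β ^ 3 := by positivity
  have hpi1 := Real.pi_gt_d4
  have hpi2 := Real.pi_lt_d4
  have hpi : β ≤ π := by linarith
  have hsu : Real.sin β ≤ β := Real.sin_le b0.le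
  have hsl : β - β ^ 3 / 4 < Real.sin β := by
    have := Real.sin_gt_sub_cube b0
    linarith
  have hs0 : 0 < Real.sin β := Real.sin_pos_of_pos_of_lt_pi b0 (by linarith)
  have hcl : 1 - β ^ 2 / 2 ≤ Real.cos β := Real.one_sub_sq_div_two_le_cos
  have E1 := rE_le β
  have E2 := rE_ge β
  have E0 := rE_pos β
  have P0 := rP_nonneg b0.le hpi
  have Z0 := rZ_nonneg b0.le
  have P1 : rP β ≤ 501 / 1000 * β ^ 2 := by
    unfold rP
    have a1 : Real.sin β * rE β ≤ β * 1 := mul_le_mul hsu E1 E0.le b0.le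
    have a2 : (1 - β ^ 2 / 2) * (1 - β ^ 2 / 10000) ≤ Real.cos β * rE β :=
      mul_le_mul hcl E2 (by linarith) (by linarith)
    have a3 : β * (Real.sin β * rE β) ≤ β * (β * 1) := mul_le_mul_of_nonneg_left a1 b0.le
    push_cast
    nlinarith
  have Z1 : rZ β ≤ 2502 / 10000 * β ^ 3 := by
    unfold rZ
    have a2 : (β - β ^ 3 / 4) * (1 - β ^ 2 / 10000) ≤ Real.sin β * rE β :=
      mul_le_mul hsl.le E2 (by linarith) hs0.le
    nlinarith [mul_pos hb2' hb3']
  have Zs : rZ β ≤ 1 / 100 := by nlinarith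
  have S0 : 0 ≤ rS β := by rw [rS_eq]; exact Real.sinh_nonneg_iff.mpr Z0
  have S1 : rS β ≤ 102 / 100 * rZ β := by
    unfold rS
    have a1 := Real.exp_bound_div_one_sub_of_interval Z0 (by linarith)
    have a2 := Real.add_one_le_exp (-(rZ β))
    have a3 : 1 / (1 - rZ β) ≤ 1 + 103 / 100 * rZ β := by
      rw [div_le_iff₀ (by linarith)]; nlinarith
    push_cast
    linarith
  have S2 : rS β ≤ 2553 / 10000 * β ^ 3 := by linarith
  have e3 : Real.exp (-3) ≤ 1 / 20 := by
    have a := Real.exp_one_gt_d9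
    have b : Real.exp (-3) = (Real.exp 1 ^ 3)⁻¹ := by
      rw [← Real.exp_nat_mul, ← Real.exp_neg]; norm_num
    rw [b, inv_le_comm₀ (by positivity) (by norm_num)]
    calc ((1 : ℝ) / 20)⁻¹ ≤ (2.7182818283 : ℝ) ^ 3 := by norm_num
      _ ≤ _ := by gcongr
  have G1 : rG β ≤ 1 / 10 := by
    unfold rG
    have a1 : Real.exp (-(((2 : ℕ) * 1 + β) * ((2 : ℕ) * 1 + β))) ≤ Real.exp (-3) :=
      Real.exp_le_exp.mpr (by push_cast; nlinarith)
    have a2 : Real.exp (-((-((2 : ℕ) * 1) + β) * (-((2 : ℕ) * 1) + β))) ≤ Real.exp (-3) :=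
      Real.exp_le_exp.mpr (by push_cast; nlinarith)
    exact (add_le_add a1 a2).trans (by linarith)
  have G0 : 0 < rG β := by unfold rG; positivity
  have t1 : 954 / 1000 ≤ 3 / π := by rw [le_div_iff₀ (by linarith)]; linarith
  have t2 : 3 / π ≤ 1 := by rw [div_le_iff₀ (by linarith)]; linarith
  have hW : rW β = (3 / π) * (Real.sin β * (1 - 4 / 3 * Real.sin β ^ 2 - 2 / 5 * rG β)) := by
    unfold rW; push_cast; ring
  have hq0 : 912 / 1000 ≤ 1 - 4 / 3 * Real.sin β ^ 2 - 2 / 5 * rG β := by nlinarith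
  have hq1 : 1 - 4 / 3 * Real.sin β ^ 2 - 2 / 5 * rG β ≤ 1 := by nlinarith
  have hsl2 : 99 / 100 * β ≤ Real.sin β := by nlinarith
  have W0 : 86 / 100 * β ≤ rW β := by
    rw [hW]
    have a1 : (99 / 100 * β) * (912 / 1000) ≤
      Real.sin β * (1 - 4 / 3 * Real.sin β ^ 2 - 2 / 5 * rG β) :=
      mul_le_mul hsl2 hq0 (by norm_num) hs0.le
    have a2 := mul_le_mul t1 a1 (by positivity) (by positivity)
    linarith
  have W1 : rW β ≤ β := by
    rw [hW]
    have a1 : Real.sin β * (1 - 4 / 3 * Real.sin β ^ 2 - 2 / 5 * rG β) ≤ β * 1 :=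
      mul_le_mul hsu hq1 (by linarith) b0.le
    have a2 := mul_le_mul t2 a1 (mul_nonneg hs0.le (by linarith)) (by norm_num)
    linarith
  have c0 : 581 / 1000 * β ≤ h * rW β := by
    have := mul_le_mul h1.le W0 (by positivity) (by linarith)
    linarith
  have c1 : h * rW β ≤ 13 / 100 := by
    have := mul_le_mul h2.le W1 (by linarith) (by linarith)
    linarith
  set c := h * rW β with hc
  have cpos : 0 < c := by linarith only [b0, c0]
  have s0 : 578 / 1000 * β ≤ Real.sin c := by
    have a1 := Real.sin_gt_sub_cube cpos
    have hc2 : c ^ 2 ≤ 169 / 10000 := by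
      have := mul_le_mul c1 c1 cpos.le (by norm_num)
      nlinarith only [this]
    have a2 : c * c ^ 2 ≤ c * (169 / 10000) := mul_le_mul_of_nonneg_left hc2 cpos.le
    have a3 : c ^ 3 = c * c ^ 2 := by ring
    linarith only [a1, a2, a3, c0, b0]
  have s1 : Real.sin c ≤ 13 / 100 := (Real.sin_le cpos.le).trans c1
  have spos : 0 < Real.sin c := by linarith only [b0, s0]
  have hSs : rS β ≤ 1 / 10 := by linarith
  unfold rF
  rw [← hc]
  set s := Real.sin c with hs
  set S := rS β with hS
  set P := rP β with hP
  have key : (2 : ℕ) * (P * S * s * (((2 : ℕ) * 1 + (S * S - s * s)) *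
      ((S * S + s * s)⁻¹ * (S * S + s * s)⁻¹))) =
      2 * P * S * s * (2 + (S ^ 2 - s ^ 2)) / (S ^ 2 + s ^ 2) ^ 2 := by
    have : S ^ 2 + s ^ 2 ≠ 0 := by positivity
    have e : S * S + s * s = S ^ 2 + s ^ 2 := by ring
    rw [e]
    field_simp
    push_cast
    ring
  rw [key]
  have r0 : 0 ≤ 2 + (S ^ 2 - s ^ 2) := by nlinarith only [s1, spos, sq_nonneg S]
  have r1 : 2 + (S ^ 2 - s ^ 2) ≤ 201 / 100 := by nlinarith only [S0, hSs, sq_nonneg s]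
  refine ⟨by positivity, ?_⟩
  rw [div_le_iff₀ (by positivity)]
  have m1 : P * S ≤ (501 / 1000 * β ^ 2) * (2553 / 10000 * β ^ 3) :=
    mul_le_mul P1 S2 S0 (by positivity)
  have m2 : (578 / 1000 * β) ^ 3 ≤ s ^ 3 := by gcongr
  calc 2 * P * S * s * (2 + (S ^ 2 - s ^ 2)) = (P * S) * (2 * s * (2 + (S ^ 2 - s ^ 2))) := by ring
    _ ≤ ((501 / 1000 * β ^ 2) * (2553 / 10000 * β ^ 3)) * (2 * s * (201 / 100)) := by gcongr
    _ ≤ 4 * β ^ 2 * ((578 / 1000 * β) ^ 3 * s) := by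
      have : 0 < β ^ 5 * s := by positivity
      nlinarith only [this]
    _ ≤ 4 * β ^ 2 * (s ^ 3 * s) := by gcongr
    _ = 4 * β ^ 2 * (s ^ 2) ^ 2 := by ring
    _ ≤ 4 * β ^ 2 * (S ^ 2 + s ^ 2) ^ 2 := by
      gcongr
      nlinarith only [sq_nonneg S]

theorem measurable_rF (h : ℝ) : Measurable (rF h) := by
  have := continuous_rP.measurable
  have := continuous_rW.measurable
  have : Measurable rS := by
    have := continuous_rZ.measurable
    unfold rS; fun_prop
  unfold rF
  fun_prop

theorem rF_start_int {h : ℝ} (h1 : 0.676 < h) (h2 : h < 0.686) :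
    IntervalIntegrable (rF h) volume 0 (3 / 16) ∧ 0 ≤ ∫ x in (0)..(3 / 16), rF h x ∧
      ∫ x in (0)..(3 / 16), rF h x ≤ 9 / 1000 := by
  have hi : IntervalIntegrable (rF h) volume 0 (3 / 16) := by
    refine IntervalIntegrable.mono_fun (f := fun x => 4 * x ^ 2)
      ((by fun_prop : Continuous fun x : ℝ => 4 * x ^ 2).intervalIntegrable _ _)
      (measurable_rF h).aestronglyMeasurable ?_
    rw [Set.uIoc_of_le (by norm_num)]
    filter_upwards [ae_restrict_mem measurableSet_Ioc] with x hx
    have := rF_start h1 h2 hx.1 hx.2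
    rw [Real.norm_eq_abs, Real.norm_eq_abs, abs_of_nonneg this.1, abs_of_nonneg (by positivity)]
    exact this.2
  refine ⟨hi, ?_, ?_⟩
  · rw [intervalIntegral.integral_of_le (by norm_num)]
    exact setIntegral_nonneg measurableSet_Ioc fun x hx => (rF_start h1 h2 hx.1 hx.2).1
  · have : ∫ x in (0)..(3 / 16), rF h x ≤ ∫ x in (0 : ℝ)..(3 / 16), 4 * x ^ 2 := by
      refine intervalIntegral.integral_mono_on_of_le_Ioo (by norm_num) hi
        ((by fun_prop : Continuous fun x : ℝ => 4 * x ^ 2).intervalIntegrable _ _) ?_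
      intro x hx
      exact (rF_start h1 h2 hx.1 hx.2.le).2
    refine this.trans ?_
    rw [intervalIntegral.integral_const_mul, integral_pow]
    norm_num

theorem J1_eq {h : ℝ} (h1 : 0.676 < h) (h2 : h < 0.686) :
    ∫ β in Set.Ioi (0 : ℝ), iF h β =
      (∫ x in (0)..(3 / 16), rF h x) + ∫ x in (3 / 16)..π, rF h x := by
  have hp := Real.pi_pos
  rw [intervalIntegral.integral_add_adjacent_intervals (rF_start_int h1 h2).1 (numeric h1 h2).intF,
    intervalIntegral.integral_of_le hp.le]
  rw [← integral_indicator measurableSet_Ioi, ← integral_indicator measurableSet_Ioc]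
  congr 1
  funext x
  by_cases a : 0 < x
  · rw [Set.indicator_of_mem (Set.mem_Ioi.mpr a)]
    by_cases b : x ≤ π
    · rw [Set.indicator_of_mem (Set.mem_Ioc.mpr ⟨a, b⟩), iF_eq (by rwa [abs_of_pos a])]
    · rw [Set.indicator_of_notMem (fun hx => b hx.2), iF_zero (by rw [abs_of_pos a]; linarith)]
  · rw [Set.indicator_of_notMem (s := Set.Ioi 0) (fun hx => a hx), Set.indicator_of_notMem (fun hx => a hx.1)]

/-! ### Derivative of the second component -/

noncomputable def rW' (β : ℝ) : ℝ := deriv rW β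

theorem differentiable_rW : Differentiable ℝ rW := by
  unfold rW rG; fun_prop

theorem contDiff_rW : ContDiff ℝ 1 rW := by
  unfold rW rG; fun_prop

theorem continuous_rW' : Continuous rW' := contDiff_rW.continuous_deriv_one

theorem hasDerivAt_rW (β : ℝ) : HasDerivAt rW (rW' β) β := (differentiable_rW β).hasDerivAt

theorem deriv_z2 {h β : ℝ} (hβ : |β| < π) : deriv (z₂ h) β = h * rW' β := by
  have : z₂ h =ᶠ[nhds β] fun x => h * rW x := by
    have : ∀ᶠ x in nhds β, |x| < π := continuous_abs.continuousAt.eventually (gt_mem_nhds hβ)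
    filter_upwards [this] with x hx using z2_eq hx.le
  rw [this.deriv_eq]
  exact ((hasDerivAt_rW β).const_mul h).deriv

theorem deriv_z2_zero {h β : ℝ} (hβ : π < |β|) : deriv (z₂ h) β = 0 := by
  have : z₂ h =ᶠ[nhds β] fun _ => 0 := by
    have : ∀ᶠ x in nhds β, π < |x| := continuous_abs.continuousAt.eventually (lt_mem_nhds hβ)
    filter_upwards [this] with x hx using z2_zero hx
  rw [this.deriv_eq]
  exact deriv_const _ _

theorem deriv_z2_pos {h : ℝ} (h1 : 0 < h) : 0 < deriv (z₂ h) 0 := by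
  rw [deriv_z2 (by rw [abs_zero]; exact Real.pi_pos)]
  refine mul_pos h1 ?_
  have hG : Differentiable ℝ rG := by unfold rG; fun_prop
  have hs := Real.hasDerivAt_sin 0
  have hs3 := (hs.mul (hs.mul hs)).const_mul ((4 : ℕ) : ℝ)
  have := ((hs.sub (hs3.div_const ((3 : ℕ) : ℝ))).sub
    (((hs.mul (hG 0).hasDerivAt).const_mul ((2 : ℕ) : ℝ)).div_const ((5 : ℕ) : ℝ))).const_mul (3 / π)
  have e : rW' 0 = (3 / π) * (1 - 2 * rG 0 / 5) := by
    have h2 : HasDerivAt rW _ 0 := this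
    unfold rW'
    rw [h2.deriv]
    simp
  rw [e]
  have hg : rG 0 < 1 := by
    have h3 : rG 0 = Real.exp (-4) + Real.exp (-4) := by
      unfold rG
      norm_num
    rw [h3]
    have a : Real.exp (-4) = (Real.exp 4)⁻¹ := Real.exp_neg _
    have b := Real.add_one_le_exp (4 : ℝ)
    have : (Real.exp 4)⁻¹ ≤ (5 : ℝ)⁻¹ := inv_anti₀ (by norm_num) (by linarith)
    rw [a]
    linarith
  have := Real.pi_pos
  have : 0 < 1 - 2 * rG 0 / 5 := by linarith
  positivity

/-! ### Laplace type integrals -/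

/-- The building block `y ^ n e ^ (-μ y)`. -/
noncomputable def mo (n : ℕ) (μ y : ℝ) : ℝ := y ^ n * Real.exp (-(μ * y))

theorem continuous_mo (n : ℕ) (μ : ℝ) : Continuous (mo n μ) := by unfold mo; fun_prop

theorem mo_integral (n : ℕ) {μ : ℝ} (hμ : 0 < μ) :
    ∫ y in Set.Ioi (0 : ℝ), mo n μ y = (n.factorial : ℝ) / μ ^ (n + 1) := by
  have h := Real.integral_rpow_mul_exp_neg_mul_Ioi (a := (n : ℝ) + 1) (by positivity) hμ
  rw [Real.Gamma_nat_eq_factorial, add_sub_cancel_right] at h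
  simp only [Real.rpow_natCast] at h
  unfold mo
  rw [h, show ((n : ℝ) + 1) = ((n + 1 : ℕ) : ℝ) by push_cast; ring, Real.rpow_natCast, one_div,
    inv_pow]
  field_simp

theorem mo_integrable (n : ℕ) {μ : ℝ} (hμ : 0 < μ) : IntegrableOn (mo n μ) (Set.Ioi 0) :=
  .of_integral_ne_zero (by rw [mo_integral n hμ]; positivity)

theorem mo_tendsto (n : ℕ) {μ : ℝ} (hμ : 0 < μ) :
    Filter.Tendsto (mo n μ) Filter.atTop (nhds 0) := by
  have h := tendsto_rpow_mul_exp_neg_mul_atTop_nhds_zero n μ hμ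
  refine h.congr fun x => ?_
  unfold mo
  rw [Real.rpow_natCast, neg_mul]

theorem mo_osc_integrable (n : ℕ) {μ : ℝ} (hμ : 0 < μ) (a : ℝ) :
    IntegrableOn (fun y => mo n μ y * Real.sin (a * y)) (Set.Ioi 0) := by
  refine Integrable.mono (mo_integrable n hμ)
    ((continuous_mo n μ).mul (by fun_prop : Continuous fun y : ℝ => Real.sin (a * y))).aestronglyMeasurable
    (Filter.Eventually.of_forall fun y => ?_)
  rw [norm_mul]
  exact mul_le_of_le_one_right (norm_nonneg _) (Real.abs_sin_le_one _)

theorem mo_osc_tendsto (n : ℕ) {μ : ℝ} (hμ : 0 < μ) (a p q : ℝ) :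
    Filter.Tendsto (fun y => mo n μ y * (p * Real.sin (a * y) + q * Real.cos (a * y)))
      Filter.atTop (nhds 0) := by
  refine squeeze_zero_norm (a := fun y => ‖mo n μ y‖ * (|p| + |q|)) (fun y => ?_) ?_
  · rw [norm_mul]
    refine mul_le_mul_of_nonneg_left ?_ (norm_nonneg _)
    refine (norm_add_le _ _).trans (add_le_add ?_ ?_)
    · rw [norm_mul]; exact mul_le_of_le_one_right (norm_nonneg _) (Real.abs_sin_le_one _)
    · rw [norm_mul]; exact mul_le_of_le_one_right (norm_nonneg _) (Real.abs_cos_le_one _)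
  · have := (mo_tendsto n hμ).norm.mul_const (|p| + |q|)
    simpa using this

theorem hasDerivAt_expn (μ y : ℝ) :
    HasDerivAt (fun y => Real.exp (-(μ * y))) (-μ * Real.exp (-(μ * y))) y := by
  have h : HasDerivAt (fun y : ℝ => -(μ * y)) (-(μ * 1)) y := ((hasDerivAt_id y).const_mul μ).neg
  refine h.exp.congr_deriv (by ring)

theorem hasDerivAt_mo0 (μ y : ℝ) : HasDerivAt (mo 0 μ) (-μ * mo 0 μ y) y := by
  have : mo 0 μ = fun y => Real.exp (-(μ * y)) := by funext x; simp [mo]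
  rw [this]
  exact hasDerivAt_expn μ y

theorem hasDerivAt_mo1 (μ y : ℝ) :
    HasDerivAt (mo 1 μ) (mo 0 μ y - μ * (y * mo 0 μ y)) y := by
  have e : mo 1 μ = fun y => y * Real.exp (-(μ * y)) := by funext x; simp [mo]
  rw [e]
  refine ((hasDerivAt_id y).mul (hasDerivAt_expn μ y)).congr_deriv ?_
  simp only [mo, id]
  ring

theorem mo1_eq (μ y : ℝ) : mo 1 μ y = y * mo 0 μ y := by simp [mo]

theorem hasDerivAt_trig (a p q y : ℝ) :
    HasDerivAt (fun y => p * Real.sin (a * y) + q * Real.cos (a * y))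
      (a * (p * Real.cos (a * y) - q * Real.sin (a * y))) y := by
  have h : HasDerivAt (fun y : ℝ => a * y) (a * 1) y := (hasDerivAt_id y).const_mul a
  refine ((h.sin.const_mul p).add (h.cos.const_mul q)).congr_deriv (by ring)

theorem lap0 {μ : ℝ} (hμ : 0 < μ) (a : ℝ) :
    ∫ y in Set.Ioi (0 : ℝ), mo 0 μ y * Real.sin (a * y) = a * (μ * μ + a * a)⁻¹ := by
  have hD : μ * μ + a * a ≠ 0 := by
    have := mul_pos hμ hμ
    have := mul_self_nonneg a
    linarith
  have := integral_Ioi_of_hasDerivAt_of_tendsto' (a := 0) (m := 0)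
    (f := fun y => mo 0 μ y * (-(μ / (μ * μ + a * a)) * Real.sin (a * y) +
      -(a / (μ * μ + a * a)) * Real.cos (a * y)))
    (f' := fun y => mo 0 μ y * Real.sin (a * y)) (fun y _ => by
      refine ((hasDerivAt_mo0 μ y).mul (hasDerivAt_trig a _ _ y)).congr_deriv ?_
      field_simp
      ring) (mo_osc_integrable 0 hμ a) (mo_osc_tendsto 0 hμ a _ _)
  rw [this]
  simp [mo]
  field_simp

theorem lap1 {μ : ℝ} (hμ : 0 < μ) (a : ℝ) :
    ∫ y in Set.Ioi (0 : ℝ), mo 1 μ y * Real.sin (a * y) =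
      2 * a * (μ * ((μ * μ + a * a)⁻¹ * (μ * μ + a * a)⁻¹)) := by
  have hD : μ * μ + a * a ≠ 0 := by
    have := mul_pos hμ hμ
    have := mul_self_nonneg a
    linarith
  have := integral_Ioi_of_hasDerivAt_of_tendsto' (a := 0) (m := 0 + 0)
    (f := fun y => mo 1 μ y * (-(μ / (μ * μ + a * a)) * Real.sin (a * y) +
      -(a / (μ * μ + a * a)) * Real.cos (a * y)) +
      mo 0 μ y * (-((μ * μ - a * a) / (μ * μ + a * a) ^ 2) * Real.sin (a * y) +
      -(2 * a * μ / (μ * μ + a * a) ^ 2) * Real.cos (a * y)))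
    (f' := fun y => mo 1 μ y * Real.sin (a * y)) (fun y _ => by
      refine (((hasDerivAt_mo1 μ y).mul (hasDerivAt_trig a _ _ y)).add
        ((hasDerivAt_mo0 μ y).mul (hasDerivAt_trig a _ _ y))).congr_deriv ?_
      rw [mo1_eq]
      field_simp
      ring) (mo_osc_integrable 1 hμ a)
    ((mo_osc_tendsto 1 hμ a _ _).add (mo_osc_tendsto 0 hμ a _ _))
  rw [this]
  simp [mo]
  field_simp

theorem mo_sinh (n : ℕ) (l c y : ℝ) :
    mo n l y * Real.sinh (c * y) = 1 / 2 * (mo n (l - c) y - mo n (l + c) y) := by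
  unfold mo
  rw [Real.sinh_eq, show -((l - c) * y) = -(l * y) + c * y by ring,
    show -((l + c) * y) = -(l * y) + -(c * y) by ring, Real.exp_add, Real.exp_add]
  ring

theorem mo_sinh_sin (n : ℕ) {l c : ℝ} (a : ℝ) (h1 : c < l) (h2 : -c < l) :
    IntegrableOn (fun y => mo n l y * Real.sinh (c * y) * Real.sin (a * y)) (Set.Ioi 0) ∧
    ∫ y in Set.Ioi (0 : ℝ), mo n l y * Real.sinh (c * y) * Real.sin (a * y) =
      1 / 2 * ((∫ y in Set.Ioi (0 : ℝ), mo n (l - c) y * Real.sin (a * y)) -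
        ∫ y in Set.Ioi (0 : ℝ), mo n (l + c) y * Real.sin (a * y)) := by
  have e : (fun y => mo n l y * Real.sinh (c * y) * Real.sin (a * y)) = fun y =>
      1 / 2 * (mo n (l - c) y * Real.sin (a * y) - mo n (l + c) y * Real.sin (a * y)) := by
    funext y; rw [mo_sinh]; ring
  have i1 := mo_osc_integrable n (μ := l - c) (by linarith) a
  have i2 := mo_osc_integrable n (μ := l + c) (by linarith) a
  rw [e]
  refine ⟨(i1.sub i2).const_mul _, ?_⟩
  rw [integral_const_mul, integral_sub i1 i2]

theorem lapT {l c : ℝ} (a : ℝ) (h1 : c < l) (h2 : -c < l) :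
    ∫ y in Set.Ioi (0 : ℝ), mo 1 l y * Real.sinh (c * y) * Real.sin (a * y) = a * rT l a c := by
  rw [(mo_sinh_sin 1 a h1 h2).2, lap1 (by linarith), lap1 (by linarith)]
  unfold rT
  ring

theorem lapU {l c : ℝ} (a : ℝ) (h1 : c < l) (h2 : -c < l) :
    ∫ y in Set.Ioi (0 : ℝ), mo 0 l y * Real.sinh (c * y) * Real.sin (a * y) =
      a / 2 * rU l a c := by
  rw [(mo_sinh_sin 0 a h1 h2).2, lap0 (by linarith), lap0 (by linarith)]
  unfold rU
  ring

/-- The main part of the kernel. -/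
noncomputable def vV (h y : ℝ) : ℝ :=
  (mo 1 (2 * h) y + mo 1 π y) -
    2 * (Real.cos h * (Real.sin h)⁻¹) * (mo 0 π y - mo 0 (π + 2 * h) y)

theorem continuous_vV (h : ℝ) : Continuous (vV h) := by unfold vV mo; fun_prop

theorem vV_integral {h c : ℝ} (a : ℝ) (h0 : 0 < h) (h1 : h < 1) (h2 : c < 2 * h)
    (h3 : -c < 2 * h) :
    ∫ y in Set.Ioi (0 : ℝ), vV h y * Real.sinh (c * y) * Real.sin (a * y) =
      a * ((rT (2 * h) a c + rT π a c) - (Real.cos h * (Real.sin h)⁻¹) *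
        (rU π a c - rU (π + 2 * h) a c)) := by
  have hp := Real.pi_gt_three
  have i1 := mo_sinh_sin 1 a h2 h3
  have i2 := mo_sinh_sin 1 (l := π) (c := c) a (by linarith) (by linarith)
  have i3 := mo_sinh_sin 0 (l := π) (c := c) a (by linarith) (by linarith)
  have i4 := mo_sinh_sin 0 (l := π + 2 * h) (c := c) a (by linarith) (by linarith)
  have e : (fun y => vV h y * Real.sinh (c * y) * Real.sin (a * y)) = fun y =>
      (mo 1 (2 * h) y * Real.sinh (c * y) * Real.sin (a * y) +
        mo 1 π y * Real.sinh (c * y) * Real.sin (a * y)) -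
      2 * (Real.cos h * (Real.sin h)⁻¹) * (mo 0 π y * Real.sinh (c * y) * Real.sin (a * y) -
        mo 0 (π + 2 * h) y * Real.sinh (c * y) * Real.sin (a * y)) := by
    funext y; unfold vV; ring
  rw [e, integral_sub, integral_add i1.1 i2.1,
    integral_const_mul, integral_sub i3.1 i4.1, lapT a h2 h3, lapT a (by linarith) (by linarith),
    lapU a (by linarith) (by linarith), lapU a (by linarith) (by linarith)]
  · ring
  · exact i1.1.add i2.1
  · exact (i3.1.sub i4.1).const_mul _

/-! ### The kernel -/

/-- The `y`-dependent factor of the integrand of `I₂`. -/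
noncomputable def wK (h K y : ℝ) : ℝ :=
  (2 * y * Real.cosh (y * π / 2 - y * h) * Real.cosh (y * π / 2) -
    2 * Real.sinh (y * h) / Real.tan h) * Real.cosh (y * (π / 2 - h)) /
  ((Real.sinh (π * y) + K * Real.sinh (2 * h * y)) * Real.cosh (y * π / 2))

theorem measurable_wK (h K : ℝ) : Measurable (wK h K) := by
  unfold wK
  fun_prop

theorem kernel_algebra {X Q y k D : ℝ} (hX : 1 < X) (hQ : 1 < Q) (hD : D ≠ 0) :
    (2 * y * ((Q * X⁻¹ + X * Q⁻¹) / 2) * ((Q + Q⁻¹) / 2) - 2 * ((X - X⁻¹) / 2) * k) *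
      ((Q * X⁻¹ + X * Q⁻¹) / 2) / (D * ((Q + Q⁻¹) / 2)) =
    ((Q ^ 2 - (Q ^ 2)⁻¹) / 2 + (X ^ 2 - (X ^ 2)⁻¹) / 2) / D *
      (y * ((X ^ 2)⁻¹ + (Q ^ 2)⁻¹) / (1 - (X ^ 2)⁻¹ * (Q ^ 2)⁻¹) -
        2 * k * ((Q ^ 2)⁻¹ - (X ^ 2)⁻¹ * (Q ^ 2)⁻¹) /
          ((1 - (X ^ 2)⁻¹ * (Q ^ 2)⁻¹) * (1 + (Q ^ 2)⁻¹))) := by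
  have hX0 : X ≠ 0 := by positivity
  have hQ0 : Q ≠ 0 := by positivity
  have hX2 : 1 < X ^ 2 := by nlinarith
  have hQ2 : 1 < Q ^ 2 := by nlinarith
  have h1 : X ^ 2 * Q ^ 2 - 1 ≠ 0 := by nlinarith
  have h2 : Q ^ 2 + 1 ≠ 0 := by positivity
  obtain ⟨M, hM⟩ : ∃ M, M = X ^ 2 * Q ^ 2 - 1 := ⟨_, rfl⟩
  rw [← hM] at h1
  have e1 : 1 - (X ^ 2)⁻¹ * (Q ^ 2)⁻¹ = M / (X ^ 2 * Q ^ 2) := by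
    rw [hM]; field_simp
  have e2 : 1 + (Q ^ 2)⁻¹ = (Q ^ 2 + 1) / Q ^ 2 := by field_simp
  have e3 : Q + Q⁻¹ = (Q ^ 2 + 1) / Q := by field_simp
  rw [e1, e2, e3]
  field_simp
  rw [hM]
  ring

theorem wK_eq {h K y : ℝ} (hh : 0 < h) (hK : 0 < K) (hy : 0 < y) :
    wK h K y = (Real.sinh (π * y) + Real.sinh (2 * h * y)) /
        (Real.sinh (π * y) + K * Real.sinh (2 * h * y)) *
      (y * (mo 0 (2 * h) y + mo 0 π y) / (1 - mo 0 (2 * h) y * mo 0 π y) -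
        2 * (Real.cos h * (Real.sin h)⁻¹) * (mo 0 π y - mo 0 (2 * h) y * mo 0 π y) /
          ((1 - mo 0 (2 * h) y * mo 0 π y) * (1 + mo 0 π y))) := by
  have hp := Real.pi_pos
  have hX : 1 < Real.exp (h * y) := Real.one_lt_exp_iff.mpr (by positivity)
  have hQ : 1 < Real.exp (π * y / 2) := Real.one_lt_exp_iff.mpr (by positivity)
  have hD : Real.sinh (π * y) + K * Real.sinh (2 * h * y) ≠ 0 := by
    have h1 : 0 < Real.sinh (π * y) := Real.sinh_pos_iff.mpr (by positivity)
    have h2 : 0 < Real.sinh (2 * h * y) := Real.sinh_pos_iff.mpr (by positivity)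
    positivity
  have key := kernel_algebra (y := y) (k := Real.cos h * (Real.sin h)⁻¹) hX hQ hD
  have eQ2 : Real.exp (π * y / 2) ^ 2 = Real.exp (π * y) := by
    rw [← Real.exp_nat_mul]; congr 1; push_cast; ring
  have eX2 : Real.exp (h * y) ^ 2 = Real.exp (2 * h * y) := by
    rw [← Real.exp_nat_mul]; congr 1; push_cast; ring
  have m1 : mo 0 (2 * h) y = (Real.exp (h * y) ^ 2)⁻¹ := by
    rw [eX2, ← Real.exp_neg]; simp [mo]
  have m2 : mo 0 π y = (Real.exp (π * y / 2) ^ 2)⁻¹ := by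
    rw [eQ2, ← Real.exp_neg]; simp [mo]
  have c1 : Real.cosh (y * π / 2 - y * h) = (Real.exp (π * y / 2) * (Real.exp (h * y))⁻¹ +
      Real.exp (h * y) * (Real.exp (π * y / 2))⁻¹) / 2 := by
    rw [Real.cosh_eq, ← Real.exp_neg, ← Real.exp_neg, ← Real.exp_add, ← Real.exp_add]
    ring_nf
  have c2 : Real.cosh (y * π / 2) = (Real.exp (π * y / 2) + (Real.exp (π * y / 2))⁻¹) / 2 := by
    rw [Real.cosh_eq, ← Real.exp_neg]
    ring_nf
  have c3 : Real.sinh (y * h) = (Real.exp (h * y) - (Real.exp (h * y))⁻¹) / 2 := by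
    rw [Real.sinh_eq, ← Real.exp_neg]
    ring_nf
  have c4 : y * (π / 2 - h) = y * π / 2 - y * h := by ring
  have s1 : Real.sinh (π * y) = (Real.exp (π * y / 2) ^ 2 - (Real.exp (π * y / 2) ^ 2)⁻¹) / 2 := by
    rw [Real.sinh_eq, eQ2, ← Real.exp_neg]
  have s2 : Real.sinh (2 * h * y) = (Real.exp (h * y) ^ 2 - (Real.exp (h * y) ^ 2)⁻¹) / 2 := by
    rw [Real.sinh_eq, eX2, ← Real.exp_neg]
  have ht : (Real.tan h)⁻¹ = Real.cos h * (Real.sin h)⁻¹ := by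
    rw [Real.tan_eq_sin_div_cos, inv_div, div_eq_mul_inv]
  rw [m1, m2]
  unfold wK
  rw [c4, div_eq_mul_inv (2 * Real.sinh (y * h)), ht, c1, c2, c3]
  rw [key, ← s1, ← s2]

theorem rho_bound {h K y : ℝ} (hh : 0 < h) (h1 : h < 1) (hK : 0 < K) (hK1 : K < 1) (hy : 0 < y) :
    1 ≤ (Real.sinh (π * y) + Real.sinh (2 * h * y)) /
        (Real.sinh (π * y) + K * Real.sinh (2 * h * y)) ∧
    (Real.sinh (π * y) + Real.sinh (2 * h * y)) /
        (Real.sinh (π * y) + K * Real.sinh (2 * h * y)) ≤ 1 + (1 - K) := by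
  have hp := Real.pi_gt_three
  have a1 : 0 < Real.sinh (π * y) := Real.sinh_pos_iff.mpr (by positivity)
  have a2 : 0 < Real.sinh (2 * h * y) := Real.sinh_pos_iff.mpr (by positivity)
  have a3 : Real.sinh (2 * h * y) ≤ Real.sinh (π * y) :=
    Real.sinh_le_sinh.mpr (mul_le_mul_of_nonneg_right (by linarith) hy.le)
  have a4 : 0 < K * Real.sinh (2 * h * y) := by positivity
  constructor
  · rw [le_div_iff₀ (by linarith)]
    nlinarith
  · rw [div_le_iff₀ (by linarith)]
    nlinarith [mul_le_mul_of_nonneg_left a3 (by linarith : 0 ≤ 1 - K), mul_pos (by linarith : 0 < 1 - K) a4]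

/-- Elementary bounds on the kernel in terms of `t = e^{-2 h y}`, `v = e^{-πy}`. -/
theorem kernel_bound {y t v k r e x : ℝ} (hy : 0 < y) (ht0 : 0 < t) (ht1 : t < 1) (hv0 : 0 < v)
    (hv1 : v < 1) (hk0 : 0 ≤ k) (hk : k ≤ 5 / 4) (hr : 1 ≤ r) (hr2 : r ≤ 1 + e)
    (hx : 0 < x) (hu : y / (1 - t * v) ≤ y + x) :
    |r * (y * (t + v) / (1 - t * v) - 2 * k * (v - t * v) / ((1 - t * v) * (1 + v))) -
      (y * (t + v) - 2 * k * (v - t * v))| ≤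
      (t + v) * (t * v) * (y + x) + 5 / 2 * v ^ 2 + e * ((t + v) * (y + x) + 5 / 2 * v) ∧
    |r * (y * (t + v) / (1 - t * v) - 2 * k * (v - t * v) / ((1 - t * v) * (1 + v)))| ≤
      (1 + e) * ((t + v) * (y + x) + 5 / 2 * v) := by
  have htv : t * v < v := by nlinarith
  have htv0 : 0 < t * v := by positivity
  have hd : 0 < 1 - t * v := by linarith
  have hA : y * (t + v) / (1 - t * v) = (t + v) * (y / (1 - t * v)) := by ring
  have hA0 : 0 ≤ y / (1 - t * v) := by positivity
  have hq : (v - t * v) / (1 - t * v) ≤ v := by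
    rw [div_le_iff₀ hd]; nlinarith
  have hq0 : 0 ≤ (v - t * v) / (1 - t * v) := div_nonneg (by linarith) hd.le
  set q := (v - t * v) / (1 - t * v) with hqd
  set p := y / (1 - t * v) with hpd
  have hB : 2 * k * (v - t * v) / ((1 - t * v) * (1 + v)) = 2 * k * (q / (1 + v)) := by
    rw [hqd]; field_simp
  have hq1 : q / (1 + v) ≤ v := by
    rw [div_le_iff₀ (by linarith)]; nlinarith
  have hq10 : 0 ≤ q / (1 + v) := by positivity
  rw [hA, hB]
  have b1 : 0 ≤ (t + v) * p := by positivity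
  have b2 : (t + v) * p ≤ (t + v) * (y + x) := by gcongr
  have b3 : 0 ≤ 2 * k * (q / (1 + v)) := by positivity
  have b4 : 2 * k * (q / (1 + v)) ≤ 5 / 2 * v :=
    mul_le_mul (by linarith) hq1 hq10 (by norm_num)
  have hW : |(t + v) * p - 2 * k * (q / (1 + v))| ≤ (t + v) * (y + x) + 5 / 2 * v := by
    rw [abs_le]; constructor <;> nlinarith
  have hN : 0 ≤ (t + v) * (y + x) + 5 / 2 * v := by positivity
  constructor
  · have e1 : (t + v) * p - y * (t + v) = (t + v) * (t * v) * p := by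
      rw [hpd]; field_simp; ring
    have e2 : q / (1 + v) - (v - t * v) = (q / (1 + v)) * (t * v - v + t * v * v) := by
      have g1 : v - t * v = q * (1 - t * v) := (div_mul_cancel₀ _ hd.ne').symm
      have g2 : q = q / (1 + v) * (1 + v) := by field_simp
      rw [g1]
      linear_combination (-(1 - t * v)) * g2
    have e3 : r * ((t + v) * p - 2 * k * (q / (1 + v))) - (y * (t + v) - 2 * k * (v - t * v)) =
        (t + v) * (t * v) * p - 2 * k * ((q / (1 + v)) * (t * v - v + t * v * v)) +
          (r - 1) * ((t + v) * p - 2 * k * (q / (1 + v))) := by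
      rw [← e1, ← e2]; ring
    rw [e3]
    have f1 : |(t + v) * (t * v) * p| ≤ (t + v) * (t * v) * (y + x) := by
      rw [abs_of_nonneg (by positivity)]; gcongr
    have f2 : |2 * k * ((q / (1 + v)) * (t * v - v + t * v * v))| ≤ 5 / 2 * v ^ 2 := by
      rw [abs_mul, abs_mul (q / (1 + v)), abs_of_nonneg (by positivity : 0 ≤ 2 * k), abs_of_nonneg hq10]
      have : |t * v - v + t * v * v| ≤ v := by rw [abs_le]; constructor <;> nlinarith
      have g := mul_le_mul hq1 this (abs_nonneg _) hv0.le
      have := mul_le_mul (by linarith : 2 * k ≤ 5 / 2) g (by positivity) (by norm_num)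
      nlinarith
    have f3 : |(r - 1) * ((t + v) * p - 2 * k * (q / (1 + v)))| ≤
        e * ((t + v) * (y + x) + 5 / 2 * v) := by
      rw [abs_mul, abs_of_nonneg (by linarith)]
      exact mul_le_mul (by linarith) hW (abs_nonneg _) (by linarith)
    refine (abs_add_le _ _).trans (add_le_add ((abs_sub _ _).trans (add_le_add f1 f2)) f3)
  · rw [abs_mul, abs_of_nonneg (by linarith)]
    exact mul_le_mul hr2 hW (abs_nonneg _) (by linarith)

/-! ### Weighted bounds for the kernel -/

structure HRange (h : ℝ) : Prop where
  lo : 676 / 1000 < h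
  hi : h < 686 / 1000
  cot : Real.cos h * (Real.sin h)⁻¹ ≤ 5 / 4

theorem HRange.cot0 {h : ℝ} (H : HRange h) : 0 ≤ Real.cos h * (Real.sin h)⁻¹ := by
  have hp := Real.pi_gt_three
  have h1 := Real.cos_nonneg_of_neg_pi_div_two_le_of_le (x := h) (by linarith [H.lo])
    (by linarith [H.hi])
  have h2 := Real.sin_nonneg_of_nonneg_of_le_pi (x := h) (by linarith [H.lo]) (by linarith [H.hi])
  positivity

theorem HRange.ratio {h y : ℝ} (H : HRange h) (hy : 0 < y) :
    y / (1 - mo 0 (2 * h) y * mo 0 π y) ≤ y + 223 / 1000 := by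
  have hp := Real.pi_gt_d4
  have hl := H.lo
  set s := (2 * h + π) * y with hs
  have s0 : 0 < s := mul_pos (by linarith) hy
  have e : mo 0 (2 * h) y * mo 0 π y = Real.exp (-s) := by
    simp only [mo, pow_zero, one_mul]
    rw [← Real.exp_add]
    congr 1
    rw [hs]; ring
  have h1 : Real.exp (-s) ≤ 1 / (1 + s) := by
    rw [Real.exp_neg, one_div]
    exact inv_anti₀ (by linarith) (by linarith [Real.add_one_le_exp s])
  have h2 : s / (1 + s) ≤ 1 - Real.exp (-s) := by
    have : s / (1 + s) = 1 - 1 / (1 + s) := by field_simp; ring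
    linarith
  have h3 : 0 < s / (1 + s) := by positivity
  rw [e]
  calc y / (1 - Real.exp (-s)) ≤ y / (s / (1 + s)) := by gcongr
    _ = y + 1 / (2 * h + π) := by
      have : 2 * h + π ≠ 0 := by linarith
      rw [hs]; field_simp; ring
    _ ≤ y + 223 / 1000 := by
      have : 1 / (2 * h + π) ≤ 223 / 1000 := by
        rw [div_le_iff₀ (by linarith)]; linarith
      linarith

theorem mo0_lt_one {μ y : ℝ} (hμ : 0 < μ) (hy : 0 < y) : mo 0 μ y < 1 := by
  simp only [mo, pow_zero, one_mul]
  rw [Real.exp_lt_one_iff]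
  have := mul_pos hμ hy
  linarith

theorem mo0_pos (μ y : ℝ) : 0 < mo 0 μ y := by
  simp only [mo, pow_zero, one_mul]
  exact Real.exp_pos _

theorem mo0_anti {μ ν y : ℝ} (h : ν ≤ μ) (hy : 0 < y) : mo 0 μ y ≤ mo 0 ν y := by
  simp only [mo, pow_zero, one_mul]
  refine Real.exp_le_exp.mpr ?_
  have := mul_le_mul_of_nonneg_right h hy.le
  linarith

theorem mo_nonneg {n : ℕ} {μ y : ℝ} (hy : 0 < y) : 0 ≤ mo n μ y := by
  unfold mo; positivity

/-- Bound for the weighted difference of the kernel and its main part. -/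
noncomputable def dB (e y : ℝ) : ℝ :=
  (mo 3 (5344 / 1000) y + 223 / 1000 * mo 2 (5344 / 1000) y + mo 3 (7132 / 1000) y +
    223 / 1000 * mo 2 (7132 / 1000) y + 5 / 2 * mo 2 (578 / 100) y) +
  e * (mo 3 (852 / 1000) y + 223 / 1000 * mo 2 (852 / 1000) y + mo 3 (264 / 100) y +
    (223 / 1000 + 5 / 2) * mo 2 (264 / 100) y)

/-- Bound for the kernel. -/
noncomputable def wB (e y : ℝ) : ℝ :=
  (1 + e) * (mo 1 (852 / 1000) y + 223 / 1000 * mo 0 (852 / 1000) y + mo 1 (264 / 100) y +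
    (223 / 1000 + 5 / 2) * mo 0 (264 / 100) y)

/-- Bound for the weighted main part of the kernel. -/
noncomputable def vB (y : ℝ) : ℝ :=
  mo 3 (852 / 1000) y + mo 3 (264 / 100) y + 5 / 2 * mo 2 (264 / 100) y

theorem mo_split (n : ℕ) (y : ℝ) :
    mo n (5344 / 1000) y = y ^ n * (mo 0 (1352 / 1000) y * mo 0 (1352 / 1000) y *
      mo 0 (314 / 100) y * Real.exp (y / 2)) ∧
    mo n (7132 / 1000) y = y ^ n * (mo 0 (314 / 100) y * mo 0 (1352 / 1000) y *
      mo 0 (314 / 100) y * Real.exp (y / 2)) ∧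
    mo n (578 / 100) y = y ^ n * (mo 0 (314 / 100) y * mo 0 (314 / 100) y * Real.exp (y / 2)) ∧
    mo n (852 / 1000) y = y ^ n * (mo 0 (1352 / 1000) y * Real.exp (y / 2)) ∧
    mo n (264 / 100) y = y ^ n * (mo 0 (314 / 100) y * Real.exp (y / 2)) := by
  simp only [mo, pow_zero, one_mul, ← Real.exp_add]
  refine ⟨?_, ?_, ?_, ?_, ?_⟩ <;> congr 2 <;> ring

theorem HRange.bounds {h K y : ℝ} (H : HRange h) (hK : 0 < K) (hK1 : K < 1) (hy : 0 < y) :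
    |wK h K y - vV h y| * (y ^ 2 * Real.exp (y / 2)) ≤ dB (1 - K) y ∧
    |wK h K y| * Real.exp (y / 2) ≤ wB (1 - K) y ∧
    |vV h y| * (y ^ 2 * Real.exp (y / 2)) ≤ vB y := by
  have hp := Real.pi_gt_d4
  have hl := H.lo
  have hi := H.hi
  have r := rho_bound (h := h) (by linarith) (by linarith) hK hK1 hy
  have kb := kernel_bound hy (mo0_pos (2 * h) y) (mo0_lt_one (by linarith) hy) (mo0_pos π y)
    (mo0_lt_one (by linarith) hy) H.cot0 H.cot r.1 r.2 (by norm_num) (H.ratio hy)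
  rw [← wK_eq (by linarith) hK hy] at kb
  have ev : vV h y = y * (mo 0 (2 * h) y + mo 0 π y) -
      2 * (Real.cos h * (Real.sin h)⁻¹) * (mo 0 π y - mo 0 (2 * h) y * mo 0 π y) := by
    have e0 : mo 0 (π + 2 * h) y = mo 0 (2 * h) y * mo 0 π y := by
      simp only [mo, pow_zero, one_mul, ← Real.exp_add]
      congr 1; ring
    unfold vV
    rw [e0, mo1_eq, mo1_eq]
    ring
  have t1 := mo0_anti (μ := 2 * h) (ν := 1352 / 1000) (by linarith) hy
  have v1 := mo0_anti (μ := π) (ν := 314 / 100) (by linarith) hy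
  have t0 := mo0_pos (2 * h) y
  have v0 := mo0_pos π y
  have hv1 := mo0_lt_one (μ := π) (by linarith) hy
  have ht1 := mo0_lt_one (μ := 2 * h) (by linarith) hy
  have T0 := mo0_pos (1352 / 1000) y
  have V0 := mo0_pos (314 / 100) y
  have E0 := Real.exp_pos (y / 2)
  have hc0 := H.cot0
  have hc1 := H.cot
  have hvb : |vV h y| ≤ y * (mo 0 (2 * h) y + mo 0 π y) + 5 / 2 * mo 0 π y := by
    rw [ev]
    refine (abs_sub _ _).trans (add_le_add ?_ ?_)
    · rw [abs_of_nonneg (by positivity)]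
    · have g : 0 ≤ mo 0 π y - mo 0 (2 * h) y * mo 0 π y := by nlinarith
      rw [abs_of_nonneg (by positivity)]
      refine mul_le_mul (by linarith) ?_ g (by norm_num)
      have := mul_pos t0 v0
      linarith
  rw [← ev] at kb
  unfold dB wB vB
  obtain ⟨a1, a2, a3, a4, a5⟩ := mo_split 3 y
  obtain ⟨b1, b2, b3, b4, b5⟩ := mo_split 2 y
  obtain ⟨-, -, -, c4, c5⟩ := mo_split 1 y
  obtain ⟨-, -, -, d4, d5⟩ := mo_split 0 y
  rw [a1, a2, a4, a5, b1, b2, b3, b4, b5, c4, c5, d4, d5]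
  set t := mo 0 (2 * h) y
  set v := mo 0 π y
  set T := mo 0 (1352 / 1000) y
  set V := mo 0 (314 / 100) y
  set E := Real.exp (y / 2)
  have hK' : 0 < 1 - K := by linarith
  obtain ⟨k1, k2⟩ := kb
  clear_value t v T V E
  refine ⟨?_, ?_, ?_⟩
  · calc |wK h K y - vV h y| * (y ^ 2 * E) ≤ ((t + v) * (t * v) * (y + 223 / 1000) +
          5 / 2 * v ^ 2 + (1 - K) * ((t + v) * (y + 223 / 1000) + 5 / 2 * v)) * (y ^ 2 * E) := by
          gcongr
      _ ≤ ((T + V) * (T * V) * (y + 223 / 1000) +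
          5 / 2 * V ^ 2 + (1 - K) * ((T + V) * (y + 223 / 1000) + 5 / 2 * V)) * (y ^ 2 * E) := by
          gcongr
      _ = _ := by ring
  · calc |wK h K y| * E ≤ ((1 + (1 - K)) * ((t + v) * (y + 223 / 1000) + 5 / 2 * v)) * E := by
          gcongr
      _ ≤ ((1 + (1 - K)) * ((T + V) * (y + 223 / 1000) + 5 / 2 * V)) * E := by gcongr
      _ = _ := by ring
  · calc |vV h y| * (y ^ 2 * E) ≤ (y * (t + v) + 5 / 2 * v) * (y ^ 2 * E) := by gcongr
      _ ≤ (y * (T + V) + 5 / 2 * V) * (y ^ 2 * E) := by gcongr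
      _ = _ := by ring

theorem wB_integrable (e : ℝ) : IntegrableOn (wB e) (Set.Ioi 0) := by
  have i (n : ℕ) := mo_integrable n (μ := 852 / 1000) (by norm_num)
  have j (n : ℕ) := mo_integrable n (μ := 264 / 100) (by norm_num)
  exact ((((i 1).add ((i 0).const_mul _)).add (j 1)).add ((j 0).const_mul _)).const_mul _

theorem vB_integrable : IntegrableOn vB (Set.Ioi 0) := by
  have i (n : ℕ) := mo_integrable n (μ := 852 / 1000) (by norm_num)
  have j (n : ℕ) := mo_integrable n (μ := 264 / 100) (by norm_num)
  exact ((i 3).add (j 3)).add ((j 2).const_mul _)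

theorem dB_integral {e : ℝ} (he : e ≤ 1 / 1000000) :
    IntegrableOn (dB e) (Set.Ioi 0) ∧ ∫ y in Set.Ioi (0 : ℝ), dB e y ≤ 4 / 100 := by
  have i (n : ℕ) := mo_integrable n (μ := 852 / 1000) (by norm_num)
  have j (n : ℕ) := mo_integrable n (μ := 264 / 100) (by norm_num)
  have k (n : ℕ) := mo_integrable n (μ := 5344 / 1000) (by norm_num)
  have l (n : ℕ) := mo_integrable n (μ := 7132 / 1000) (by norm_num)
  have m (n : ℕ) := mo_integrable n (μ := 578 / 100) (by norm_num)
  have s1 := (k 3).add ((k 2).const_mul (223 / 1000))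
  have s2 := s1.add (l 3)
  have s3 := s2.add ((l 2).const_mul (223 / 1000))
  have s4 := s3.add ((m 2).const_mul (5 / 2))
  have r1 := (i 3).add ((i 2).const_mul (223 / 1000))
  have r2 := r1.add (j 3)
  have r3 := r2.add ((j 2).const_mul (223 / 1000 + 5 / 2))
  have r4 := r3.const_mul e
  refine ⟨s4.add r4, ?_⟩
  have q1 := integral_add' (k 3) ((k 2).const_mul (223 / 1000))
  have q2 := integral_add' s1 (l 3)
  have q3 := integral_add' s2 ((l 2).const_mul (223 / 1000))
  have q4 := integral_add' s3 ((m 2).const_mul (5 / 2))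
  have p1 := integral_add' (i 3) ((i 2).const_mul (223 / 1000))
  have p2 := integral_add' r1 (j 3)
  have p3 := integral_add' r2 ((j 2).const_mul (223 / 1000 + 5 / 2))
  have p4 := integral_add' s4 r4
  have p5 : ∫ y in Set.Ioi (0 : ℝ), dB e y = _ := p4
  rw [p5, q4, q3, q2, q1, integral_const_mul e, p3, p2, p1]
  simp only [integral_const_mul]
  rw [mo_integral _ (by norm_num), mo_integral _ (by norm_num), mo_integral _ (by norm_num),
    mo_integral _ (by norm_num), mo_integral _ (by norm_num), mo_integral _ (by norm_num),
    mo_integral _ (by norm_num), mo_integral _ (by norm_num), mo_integral _ (by norm_num)]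
  norm_num [Nat.factorial]
  linarith

/-! ### The double integral -/

theorem rW_abs {β : ℝ} (h0 : 0 ≤ β) : |rW β| ≤ 72 / 100 := by
  have hp := Real.pi_gt_three
  have e : rW β = (3 / π) * (Real.sin (3 * β) / 3 - 2 / 5 * (Real.sin β * rG β)) := by
    unfold rW
    rw [Real.sin_three_mul]
    push_cast
    ring
  have e4 : Real.exp (-4) ≤ 1 / 25 := by
    have := Real.add_one_le_exp (2 : ℝ)
    have h2 : Real.exp 4 = Real.exp 1 ^ 4 := by rw [← Real.exp_nat_mul]; norm_num
    have h3 := Real.exp_one_gt_d9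
    have h4 : (2.5 : ℝ) ^ 4 ≤ Real.exp 1 ^ 4 := by gcongr; linarith
    rw [Real.exp_neg, h2, inv_le_comm₀ (by positivity) (by norm_num)]
    norm_num at h4 ⊢
    linarith
  have g1 : rG β ≤ 26 / 25 := by
    unfold rG
    have a1 : Real.exp (-(((2 : ℕ) * 1 + β) * ((2 : ℕ) * 1 + β))) ≤ Real.exp (-4) := by
      apply Real.exp_le_exp.2
      push_cast
      nlinarith
    have a2 : Real.exp (-((-((2 : ℕ) * 1) + β) * (-((2 : ℕ) * 1) + β))) ≤ 1 := by
      rw [Real.exp_le_one_iff]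
      nlinarith [sq_nonneg (-((2 : ℕ) * 1) + β)]
    exact (add_le_add a1 a2).trans (by linarith)
  have g0 : 0 ≤ rG β := by unfold rG; positivity
  have s1 := Real.abs_sin_le_one (3 * β)
  have s2 : |Real.sin β * rG β| ≤ 26 / 25 := by
    rw [abs_mul, abs_of_nonneg g0]
    nlinarith [Real.abs_sin_le_one β, abs_nonneg (Real.sin β)]
  have s3 : |Real.sin (3 * β) / 3 - 2 / 5 * (Real.sin β * rG β)| ≤ 75 / 100 := by
    rw [abs_le] at s1 s2 ⊢
    constructor <;> linarith
  have p1 : 3 / π ≤ 96 / 100 := by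
    rw [div_le_iff₀ Real.pi_pos]; linarith [Real.pi_gt_d2]
  rw [e, abs_mul, abs_of_pos (by positivity)]
  calc _ ≤ 96 / 100 * (75 / 100 : ℝ) := by gcongr
    _ ≤ _ := by norm_num

theorem HRange.c_abs {h β : ℝ} (H : HRange h) (h0 : 0 ≤ β) : |h * rW β| ≤ 1 / 2 := by
  have := rW_abs h0
  have h1 := H.lo
  rw [abs_mul, abs_of_pos (by linarith)]
  nlinarith [H.hi, abs_nonneg (rW β)]

theorem rW_zero : rW 0 = 0 := by simp [rW]
theorem rW_pi : rW π = 0 := by simp [rW]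

theorem abs_sinh_le (x : ℝ) : |Real.sinh x| ≤ |x| * Real.exp |x| := by
  rw [Real.abs_sinh, Real.sinh_eq]
  set t := |x|
  have h := Real.add_one_le_exp (-(2 * t))
  have e : Real.exp (-t) = Real.exp t * Real.exp (-(2 * t)) := by
    rw [← Real.exp_add]; congr 1; ring
  rw [e]
  nlinarith [Real.exp_pos t]

noncomputable def fQ (h y γ : ℝ) : ℝ :=
  rP γ * Real.sinh (h * rW γ * y) * Real.sin (rZ γ * y)
noncomputable def fF (h y : ℝ) : ℝ := ∫ γ in (0)..π, fQ h y γ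

theorem continuous_fQ (h : ℝ) : Continuous (Function.uncurry (fQ h)) := by
  have h1 := continuous_rP
  have h2 := continuous_rW
  have h3 := continuous_rZ
  unfold fQ Function.uncurry
  fun_prop

theorem continuous_fF (h : ℝ) : Continuous (fF h) :=
  intervalIntegral.continuous_parametric_intervalIntegral_of_continuous' (continuous_fQ h) 0 π

theorem HRange.fQ_bound {h y γ : ℝ} (H : HRange h) (hy : 0 < y) (h0 : 0 ≤ γ) :
    |fQ h y γ| ≤ y ^ 2 * Real.exp (y / 2) * (h * |rM γ|) := by
  have hc := H.c_abs h0
  have hh : 0 < h := by linarith [H.lo]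
  unfold fQ rM
  have e1 : |Real.sinh (h * rW γ * y)| ≤ h * |rW γ| * y * Real.exp (y / 2) := by
    refine (abs_sinh_le _).trans ?_
    have : |h * rW γ * y| ≤ y / 2 := by
      rw [abs_mul, abs_of_pos hy]; nlinarith
    have e : |h * rW γ * y| = h * |rW γ| * y := by
      rw [abs_mul, abs_mul, abs_of_pos hy, abs_of_pos hh]
    calc _ ≤ |h * rW γ * y| * Real.exp (y / 2) := by gcongr
      _ = _ := by rw [e]
  have e2 : |Real.sin (rZ γ * y)| ≤ |rZ γ| * y := by
    refine Real.abs_sin_le_abs.trans ?_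
    rw [abs_mul, abs_of_pos hy]
  rw [abs_mul, abs_mul, abs_mul, abs_mul]
  calc _ ≤ |rP γ| * (h * |rW γ| * y * Real.exp (y / 2)) * (|rZ γ| * y) := by gcongr
    _ = _ := by ring

theorem HRange.fF_bound {h y : ℝ} (H : HRange h) (hy : 0 < y) :
    |fF h y| ≤ y ^ 2 * Real.exp (y / 2) * (74 / 100) := by
  have hh : 0 < h := by linarith [H.lo]
  have h1 : |fF h y| ≤ ∫ γ in (0)..π, y ^ 2 * Real.exp (y / 2) * (h * |rM γ|) := by
    unfold fF
    rw [← Real.norm_eq_abs]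
    refine intervalIntegral.norm_integral_le_of_norm_le Real.pi_pos.le ?_ ?_
    · refine Filter.Eventually.of_forall fun γ hγ => ?_
      rw [Real.norm_eq_abs]
      exact H.fQ_bound hy hγ.1.le
    · have := continuous_rM
      apply Continuous.intervalIntegrable
      fun_prop
  refine h1.trans ?_
  rw [intervalIntegral.integral_const_mul, intervalIntegral.integral_const_mul]
  have := weight_bound
  have hi := H.hi
  gcongr
  have i0 : 0 ≤ ∫ γ in (0)..π, |rM γ| :=
    intervalIntegral.integral_nonneg Real.pi_pos.le fun γ _ => abs_nonneg _
  calc _ ≤ 686 / 1000 * (107 / 100 : ℝ) := by gcongr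
    _ ≤ _ := by norm_num

theorem HRange.parts {h y : ℝ} (hy : 0 < y) :
    ∫ γ in Set.Ioi (0 : ℝ), deriv (z₂ h) γ * Real.cos (z₁ γ * y) * Real.cosh (y * z₂ h γ) =
      fF h y := by
  have e1 : ∫ γ in Set.Ioi (0 : ℝ),
      deriv (z₂ h) γ * Real.cos (z₁ γ * y) * Real.cosh (y * z₂ h γ) =
      ∫ γ in Set.Ioc (0 : ℝ) π, h * rW' γ * Real.cos (rZ γ * y) * Real.cosh (y * (h * rW γ)) := by
    rw [← integral_indicator measurableSet_Ioi, ← integral_indicator measurableSet_Ioc]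
    apply integral_congr_ae
    have : ∀ᵐ γ : ℝ, γ ≠ π := by simp [ae_iff]
    filter_upwards [this] with γ hγ
    by_cases a : 0 < γ
    · rcases lt_or_gt_of_ne hγ with b | b
      · have c : |γ| < π := by rwa [abs_of_pos a]
        rw [Set.indicator_of_mem (by exact a), Set.indicator_of_mem (by exact ⟨a, b.le⟩),
          deriv_z2 c, z2_eq c.le, z1_eq]
      · have c : π < |γ| := by rwa [abs_of_pos a]
        rw [Set.indicator_of_mem (by exact a), Set.indicator_of_notMem (by
          rintro ⟨_, d⟩; linarith), deriv_z2_zero c]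
        simp
    · rw [Set.indicator_of_notMem (by exact a), Set.indicator_of_notMem (by exact fun d => a d.1)]
  rw [e1, ← intervalIntegral.integral_of_le Real.pi_pos.le]
  have c1 := continuous_rP
  have c2 := continuous_rW
  have c3 := continuous_rZ
  have c4 := continuous_rW'
  have hd : ∀ γ ∈ Set.uIcc 0 π, HasDerivAt
      (fun γ => Real.sinh (h * rW γ * y) * Real.cos (rZ γ * y) / y)
      (h * rW' γ * Real.cos (rZ γ * y) * Real.cosh (y * (h * rW γ)) - fQ h y γ) γ := by
    intro γ _
    have a := (((hasDerivAt_rW γ).const_mul h).mul_const y).sinh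
    have b := ((hasDerivAt_rZ γ).mul_const y).cos
    refine ((a.mul b).div_const y).congr_deriv ?_
    unfold fQ
    rw [mul_comm y (h * rW γ)]
    field_simp
    ring
  have i1 : IntervalIntegrable
      (fun γ => h * rW' γ * Real.cos (rZ γ * y) * Real.cosh (y * (h * rW γ))) volume 0 π := by
    apply Continuous.intervalIntegrable
    fun_prop
  have i2 : IntervalIntegrable (fun γ => fQ h y γ) volume 0 π := by
    apply Continuous.intervalIntegrable
    unfold fQ
    fun_prop
  have := intervalIntegral.integral_eq_sub_of_hasDerivAt hd (i1.sub i2)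
  rw [intervalIntegral.integral_sub i1 i2, rW_pi, rW_zero] at this
  simp only [mul_zero, zero_mul, Real.sinh_zero, zero_div, sub_zero] at this
  unfold fF
  linarith

theorem integrable_deriv_z2 (h : ℝ) : IntegrableOn (deriv (z₂ h)) (Set.Ioi 0) := by
  have h1 : IntegrableOn (fun γ => h * rW' γ) (Set.Ioo 0 π) := by
    have := continuous_rW'
    have c : Continuous (fun γ => h * rW' γ) := by fun_prop
    exact (c.integrableOn_Icc (a := 0) (b := π)).mono_set Set.Ioo_subset_Icc_self
  have h2 : IntegrableOn (deriv (z₂ h)) (Set.Ioo 0 π) := by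
    refine h1.congr_fun (fun γ hγ => ?_) measurableSet_Ioo
    exact (deriv_z2 (by rw [abs_of_pos hγ.1]; exact hγ.2)).symm
  have h3 : IntegrableOn (deriv (z₂ h)) (Set.Ioi π) := by
    refine (integrableOn_zero (ε' := ℝ)).congr_fun (fun γ hγ => ?_) measurableSet_Ioi
    have : π < γ := hγ
    exact (deriv_z2_zero (by rw [abs_of_pos (Real.pi_pos.trans this)]; exact this)).symm
  have h4 : IntegrableOn (deriv (z₂ h)) (Set.Ici π) := (integrableOn_Ici_iff_integrableOn_Ioi (by simp)).2 h3
  have := h2.union h4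
  rwa [Set.Ioo_union_Ici_eq_Ioi Real.pi_pos] at this

theorem measurable_z2 (h : ℝ) : Measurable (z₂ h) := by
  unfold z₂
  apply Measurable.ite
  · exact measurableSet_le (by fun_prop) (by fun_prop)
  · fun_prop
  · fun_prop

noncomputable def gG (h K : ℝ) (p : ℝ × ℝ) : ℝ :=
  wK h K p.1 * (deriv (z₂ h) p.2 * Real.cos (z₁ p.2 * p.1) * Real.cosh (p.1 * z₂ h p.2))

theorem cosh_le_exp_abs (x : ℝ) : Real.cosh x ≤ Real.exp |x| := by
  rw [← Real.cosh_abs, Real.cosh_eq]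
  have : Real.exp (-|x|) ≤ Real.exp |x| := Real.exp_le_exp.2 (by linarith [abs_nonneg x])
  linarith

theorem HRange.z2_abs {h γ : ℝ} (H : HRange h) (h0 : 0 < γ) : |z₂ h γ| ≤ 1 / 2 := by
  by_cases a : |γ| ≤ π
  · rw [z2_eq a]; exact H.c_abs h0.le
  · rw [z2_zero (not_le.1 a)]; norm_num

theorem HRange.gG_int {h K : ℝ} (H : HRange h) (hK : 0 < K) (hK1 : K < 1) :
    IntegrableOn (gG h K) (Set.Ioi 0 ×ˢ Set.Ioi 0) (volume.prod volume) := by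
  have i : IntegrableOn (fun p : ℝ × ℝ => wB (1 - K) p.1 * |deriv (z₂ h) p.2|)
      (Set.Ioi 0 ×ˢ Set.Ioi 0) (volume.prod volume) := by
    unfold IntegrableOn
    rw [← Measure.prod_restrict]
    exact Integrable.mul_prod (wB_integrable (1 - K)) (integrable_deriv_z2 h).abs
  refine Integrable.mono' i ?_ ?_
  · apply Measurable.aestronglyMeasurable
    have h1 := measurable_wK h K
    have h2 := measurable_z2 h
    have h3 : Measurable z₁ := by rw [z1_eq]; exact continuous_rZ.measurable
    have h4 : Measurable (deriv (z₂ h)) := measurable_deriv _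
    unfold gG
    fun_prop
  · refine (ae_restrict_iff' (measurableSet_Ioi.prod measurableSet_Ioi)).2
      (Filter.Eventually.of_forall ?_)
    rintro ⟨y, γ⟩ ⟨hy, hγ⟩
    simp only [Set.mem_Ioi] at hy hγ
    obtain ⟨-, b, -⟩ := H.bounds hK hK1 hy
    have z := H.z2_abs hγ
    rw [Real.norm_eq_abs]
    simp only [gG]
    rw [abs_mul, abs_mul, abs_mul, abs_of_pos (Real.cosh_pos _)]
    have c : Real.cosh (y * z₂ h γ) ≤ Real.exp (y / 2) := by
      refine (cosh_le_exp_abs _).trans (Real.exp_le_exp.2 ?_)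
      rw [abs_mul, abs_of_pos hy]
      nlinarith
    calc _ ≤ |wK h K y| * (|deriv (z₂ h) γ| * 1 * Real.exp (y / 2)) := by
          gcongr
          exact Real.abs_cos_le_one _
      _ = |wK h K y| * Real.exp (y / 2) * |deriv (z₂ h) γ| := by ring
      _ ≤ _ := by gcongr

theorem HRange.gG_eq {h K : ℝ} (H : HRange h) (hK : 0 < K) (hK1 : K < 1) :
    ∫ p in Set.Ioi (0 : ℝ) ×ˢ Set.Ioi (0 : ℝ), gG h K p =
      ∫ y in Set.Ioi (0 : ℝ), wK h K y * fF h y := by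
  have := setIntegral_prod (μ := volume) (ν := volume) (gG h K) (H.gG_int hK hK1)
  rw [← Measure.volume_eq_prod] at this
  rw [this]
  refine setIntegral_congr_fun measurableSet_Ioi fun y hy => ?_
  simp only [gG]
  rw [integral_const_mul, HRange.parts hy]

theorem I2_eq (h K : ℝ) : I₂ h K = 4 * deriv (z₂ h) 0 * K *
    ∫ p in Set.Ioi (0 : ℝ) ×ˢ Set.Ioi (0 : ℝ), gG h K p := by
  unfold I₂
  congr 1
  apply integral_congr_ae
  refine Filter.Eventually.of_forall fun p => ?_
  simp only [gG, wK]
  ring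

theorem HRange.vQ_int {h : ℝ} (H : HRange h) :
    Integrable (Function.uncurry fun y γ => vV h y * fQ h y γ)
      ((volume.restrict (Set.Ioi 0)).prod (volume.restrict (Set.Ioc 0 π))) := by
  have hh : 0 < h := by linarith [H.lo]
  have i : Integrable (fun p : ℝ × ℝ => vB p.1 * (h * |rM p.2|))
      ((volume.restrict (Set.Ioi 0)).prod (volume.restrict (Set.Ioc 0 π))) := by
    refine Integrable.mul_prod (f := vB) (g := fun γ => h * |rM γ|) vB_integrable ?_
    have := continuous_rM
    have c : Continuous (fun γ => h * |rM γ|) := by fun_prop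
    exact (c.integrableOn_Icc (a := 0) (b := π)).mono_set Set.Ioc_subset_Icc_self
  refine Integrable.mono' i ?_ ?_
  · apply Continuous.aestronglyMeasurable
    have h1 := continuous_vV h
    have h2 : Continuous fun p : ℝ × ℝ => fQ h p.1 p.2 := continuous_fQ h
    unfold Function.uncurry
    fun_prop
  · rw [Measure.prod_restrict]
    refine (ae_restrict_iff' (measurableSet_Ioi.prod measurableSet_Ioc)).2
      (Filter.Eventually.of_forall ?_)
    rintro ⟨y, γ⟩ ⟨hy, hγ⟩
    simp only [Set.mem_Ioi] at hy
    have hγ0 : 0 < γ := hγ.1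
    obtain ⟨-, -, b⟩ := H.bounds (K := 1 / 2) (by norm_num) (by norm_num) hy
    have q := H.fQ_bound hy hγ0.le
    rw [Real.norm_eq_abs]
    simp only [Function.uncurry]
    rw [abs_mul]
    calc _ ≤ |vV h y| * (y ^ 2 * Real.exp (y / 2) * (h * |rM γ|)) := by gcongr
      _ = |vV h y| * (y ^ 2 * Real.exp (y / 2)) * (h * |rM γ|) := by ring
      _ ≤ _ := by gcongr

theorem HRange.vF_eq {h : ℝ} (H : HRange h) :
    ∫ y in Set.Ioi (0 : ℝ), vV h y * fF h y = ∫ x in (0)..π, rV h x := by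
  have hl := H.lo
  have hi := H.hi
  have e : ∀ y, vV h y * fF h y = ∫ γ in Set.Ioc 0 π, vV h y * fQ h y γ := by
    intro y
    rw [integral_const_mul, fF, intervalIntegral.integral_of_le Real.pi_pos.le]
  simp only [e]
  rw [integral_integral_swap H.vQ_int, intervalIntegral.integral_of_le Real.pi_pos.le]
  refine setIntegral_congr_fun measurableSet_Ioc fun γ hγ => ?_
  have hc := abs_le.1 (H.c_abs hγ.1.le)
  have := vV_integral (h := h) (c := h * rW γ) (rZ γ) (by linarith) (by linarith)
    (by linarith) (by linarith)
  have e2 : ∀ y, vV h y * fQ h y γ =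
      rP γ * (vV h y * Real.sinh (h * rW γ * y) * Real.sin (rZ γ * y)) := by
    intro y; unfold fQ; ring
  simp only [e2]
  rw [integral_const_mul, this]
  unfold rV
  push_cast
  ring

theorem HRange.X_le {h K : ℝ} (H : HRange h) (hK : 0 < K) (hK1 : K < 1)
    (hK2 : 1 - K ≤ 1 / 1000000) :
    ∫ y in Set.Ioi (0 : ℝ), wK h K y * fF h y ≤ (∫ x in (0)..π, rV h x) + 3 / 100 := by
  obtain ⟨di, dv⟩ := dB_integral hK2
  have i1 : IntegrableOn (fun y => vV h y * fF h y) (Set.Ioi 0) := by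
    refine Integrable.mono' (vB_integrable.mul_const (74 / 100)) ?_ ?_
    · exact ((continuous_vV h).mul (continuous_fF h)).aestronglyMeasurable
    · refine (ae_restrict_iff' measurableSet_Ioi).2 (Filter.Eventually.of_forall fun y hy => ?_)
      obtain ⟨-, -, b⟩ := H.bounds hK hK1 hy
      rw [Real.norm_eq_abs, abs_mul]
      calc _ ≤ |vV h y| * (y ^ 2 * Real.exp (y / 2) * (74 / 100)) := by
            gcongr; exact H.fF_bound hy
        _ = |vV h y| * (y ^ 2 * Real.exp (y / 2)) * (74 / 100) := by ring
        _ ≤ _ := by gcongr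
  have bd : ∀ y ∈ Set.Ioi (0 : ℝ),
      ‖(wK h K y - vV h y) * fF h y‖ ≤ dB (1 - K) y * (74 / 100) := by
    intro y hy
    obtain ⟨b, -, -⟩ := H.bounds hK hK1 hy
    rw [Real.norm_eq_abs, abs_mul]
    calc _ ≤ |wK h K y - vV h y| * (y ^ 2 * Real.exp (y / 2) * (74 / 100)) := by
          gcongr; exact H.fF_bound hy
      _ = |wK h K y - vV h y| * (y ^ 2 * Real.exp (y / 2)) * (74 / 100) := by ring
      _ ≤ _ := by gcongr
  have i2 : IntegrableOn (fun y => (wK h K y - vV h y) * fF h y) (Set.Ioi 0) := by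
    refine Integrable.mono' (di.mul_const (74 / 100)) ?_ ?_
    · exact (((measurable_wK h K).sub (continuous_vV h).measurable).mul
        (continuous_fF h).measurable).aestronglyMeasurable
    · exact (ae_restrict_iff' measurableSet_Ioi).2 (Filter.Eventually.of_forall bd)
  have i3 : ∫ y in Set.Ioi (0 : ℝ), (wK h K y - vV h y) * fF h y ≤ 3 / 100 := by
    have : ∫ y in Set.Ioi (0 : ℝ), (wK h K y - vV h y) * fF h y ≤
        ∫ y in Set.Ioi (0 : ℝ), dB (1 - K) y * (74 / 100) :=
      setIntegral_mono_on i2 (di.mul_const _) measurableSet_Ioi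
        fun y hy => (le_abs_self _).trans (bd y hy)
    rw [integral_mul_const] at this
    linarith
  have e : ∀ y, wK h K y * fF h y = vV h y * fF h y + (wK h K y - vV h y) * fF h y := by
    intro y; ring
  simp only [e]
  rw [integral_add i1 i2, H.vF_eq]
  linarith

theorem main_aux {h : ℝ} (h1 : 0.676 < h) (h2 : h < 0.686) :
    0 < I₁ h ∧ ∃ K : ℝ, -1 < K ∧ K < 1 ∧ I₁ h + I₂ h K < 0 := by
  have N := numeric h1 h2
  obtain ⟨-, a0, a1⟩ := rF_start_int h1 h2
  have J := J1_eq h1 h2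
  have H : HRange h := ⟨by norm_num at h1 ⊢; linarith, by norm_num at h2 ⊢; linarith, N.cot⟩
  have hz : 0 < deriv (z₂ h) 0 := deriv_z2_pos (by linarith [H.lo])
  have e1 : I₁ h = 2 * deriv (z₂ h) 0 * ∫ β in Set.Ioi (0 : ℝ), iF h β := rfl
  set j := ∫ β in Set.Ioi (0 : ℝ), iF h β with hj
  have n1 := N.lower
  have n2 := N.upper
  have j0 : 0 < j := by rw [J]; linarith
  refine ⟨by rw [e1]; positivity, ?_⟩
  set ε := min (1 / 1000000) (1 / 1000 / (1 + j)) with hε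
  have ε0 : 0 < ε := by positivity
  have ε1 : ε ≤ 1 / 1000000 := min_le_left _ _
  have ε2 : ε * j ≤ 1 / 1000 := by
    have : ε ≤ 1 / 1000 / (1 + j) := min_le_right _ _
    rw [le_div_iff₀ (by positivity)] at this
    nlinarith
  have X := H.X_le (K := 1 - ε) (by linarith) (by linarith) (by linarith)
  rw [← H.gG_eq (by linarith) (by linarith)] at X
  refine ⟨1 - ε, by linarith, by linarith, ?_⟩
  rw [e1, I2_eq]
  set x := ∫ p in Set.Ioi (0 : ℝ) ×ˢ Set.Ioi (0 : ℝ), gG h (1 - ε) p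
  have k : j + 2 * x ≤ -(11 / 1000) := by linarith
  have : j + 2 * (1 - ε) * x < 0 := by nlinarith
  have e : 2 * deriv (z₂ h) 0 * j + 4 * deriv (z₂ h) 0 * (1 - ε) * x =
      2 * deriv (z₂ h) 0 * (j + 2 * (1 - ε) * x) := by ring
  rw [e]
  exact mul_neg_of_pos_of_neg (by positivity) this

/-- For every height `0.676 < h₂ < 0.686` of the permeability jump, `I₁(h₂) > 0` (no shift
in the homogeneous case `K = 0`) but there exists a permeability jump `K ∈ (-1,1)` with
`I₁(h₂) + I₂(h₂,K) < 0`: the permeabilities help the shift. -/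
theorem inhomogeneous_muskat_permeability_helps_shift :
    ∀ h₂ : ℝ, 0.676 < h₂ → h₂ < 0.686 →
      0 < I₁ h₂ ∧ ∃ K : ℝ, -1 < K ∧ K < 1 ∧ I₁ h₂ + I₂ h₂ K < 0 := by
  intro h₂ h1 h2
  exact main_aux h1 h2
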